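/- arXiv:1211.6876 — 3 statements merged into one kernel-verified Lean document; each statement's English description precedes it below -/
import Mathlib

section
/- For an orthogonal projection p in a von Neumann algebra A and a Markov operator T, the following are equivalent: (i) there is a family (y_i) of potentials with p ≤ ⋁_i supp y_i; (ii) there is a family (x_i) ⊆ A₊ of T-summable elements with p ≤ ⋁_i supp x_i; (iii) there is a family (p_j) of T-summable orthogonal projections with p ≤ ⋁_j p_j. -/
open Filter Topology ContinuousLinearMap

namespace QMP

variable {H : Type*} [NormedAddCommGroup H] [InnerProductSpace ℂ H] [CompleteSpace H]

/-- `T` is a (quantum) Markov operator on the von Neumann algebra `A`: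
a normal, unital, completely positive linear map leaving `A` invariant. -/
structure IsMarkov (A : VonNeumannAlgebra H) (T : (H →L[ℂ] H) → (H →L[ℂ] H)) : Prop where
  linear : IsLinearMap ℂ T
  mapsSelf : ∀ x ∈ A, T x ∈ A
  unital : T 1 = 1
  cp : ∀ (n : ℕ) (a b : Fin n → (H →L[ℂ] H)),
    0 ≤ ∑ i : Fin n, ∑ j : Fin n, star (b i) * T (star (a i) * a j) * b j
  normal : ∀ {ι : Type} [Preorder ι] [IsDirected ι (· ≤ ·)] (f : ι → (H →L[ℂ] H))
    (y : H →L[ℂ] H), Monotone f → IsLUB (Set.range f) y →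
      IsLUB (Set.range fun i => T (f i)) (T y)

/-- `y = ∑ₙ Tⁿ x` with convergence in the strong operator topology. -/
def SOTSum (T : (H →L[ℂ] H) → (H →L[ℂ] H)) (x y : H →L[ℂ] H) : Prop :=
  ∀ η : H, Tendsto (fun N => ∑ n ∈ Finset.range N, (T^[n] x) η) atTop (𝓝 (y η))

/-- `x ∈ A₊` is `T`-summable: `∑ₙ Tⁿ x` converges strongly to an element of `A₊`. -/
def TSummable (A : VonNeumannAlgebra H) (T : (H →L[ℂ] H) → (H →L[ℂ] H))
    (x : H →L[ℂ] H) : Prop :=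
  x ∈ A ∧ 0 ≤ x ∧ ∃ y, y ∈ A ∧ 0 ≤ y ∧ SOTSum T x y

/-- `y` is a potential for `T`: `y = ∑ₙ Tⁿ x` for some `x ∈ A₊`. -/
def IsPotential (A : VonNeumannAlgebra H) (T : (H →L[ℂ] H) → (H →L[ℂ] H))
    (y : H →L[ℂ] H) : Prop :=
  y ∈ A ∧ 0 ≤ y ∧ ∃ x, x ∈ A ∧ 0 ≤ x ∧ SOTSum T x y

/-- `p` is an orthogonal projection belonging to `A`. -/
def IsProj (A : VonNeumannAlgebra H) (p : H →L[ℂ] H) : Prop :=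
  p ∈ A ∧ IsSelfAdjoint p ∧ IsIdempotentElem p

/-- `p` is the support projection of the self-adjoint element `a`. -/
def IsSupport (A : VonNeumannAlgebra H) (a p : H →L[ℂ] H) : Prop :=
  IsProj A p ∧ a = p * a * p ∧ ∀ q, IsProj A q → a = q * a * q → p ≤ q

/-- `s` is the supremum of the family of projections `q` in the projection lattice of `A`. -/
def IsProjSup (A : VonNeumannAlgebra H) {ι : Type*} (q : ι → (H →L[ℂ] H))
    (s : H →L[ℂ] H) : Prop :=
  IsProj A s ∧ (∀ i, q i ≤ s) ∧ ∀ r, IsProj A r → (∀ i, q i ≤ r) → s ≤ r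

end QMP

namespace QMP

variable {H : Type*} [NormedAddCommGroup H] [InnerProductSpace ℂ H] [CompleteSpace H]

/-- `p` is a transient projection for `T`: it is dominated by the supremum of a family of
`T`-summable projections. -/
def Transient (A : VonNeumannAlgebra H) (T : (H →L[ℂ] H) → (H →L[ℂ] H))
    (p : H →L[ℂ] H) : Prop :=
  ∃ (ι : Type) (q : ι → (H →L[ℂ] H)) (s : H →L[ℂ] H),
    (∀ i, IsProj A (q i) ∧ TSummable A T (q i)) ∧ IsProjSup A q s ∧ p ≤ s

/-- `e` is the maximal transient projection `p_Tr`: the supremum of all transient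
projections of `A`. -/
def IsMaxTransient (A : VonNeumannAlgebra H) (T : (H →L[ℂ] H) → (H →L[ℂ] H))
    (e : H →L[ℂ] H) : Prop :=
  IsProj A e ∧ (∀ p, IsProj A p → Transient A T p → p ≤ e) ∧
    ∀ r, IsProj A r → (∀ p, IsProj A p → Transient A T p → p ≤ r) → e ≤ r

end QMP

namespace QMP

section

variable {H : Type*} [NormedAddCommGroup H] [InnerProductSpace ℂ H] [CompleteSpace H]
  {A : VonNeumannAlgebra H} {T : (H →L[ℂ] H) → (H →L[ℂ] H)}

lemma IsProj.isStarProjection {p : H →L[ℂ] H} (hp : IsProj A p) : IsStarProjection p :=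
  ⟨hp.2.2, hp.2.1⟩

lemma mem_of_forall_commute {a : H →L[ℂ] H} (h : ∀ c ∈ A.commutant, c * a = a * c) : a ∈ A := by
  rw [← VonNeumannAlgebra.commutant_commutant A]
  exact VonNeumannAlgebra.mem_commutant_iff.2 h

lemma commute_of_mem_commutant {a c : H →L[ℂ] H} (ha : a ∈ A) (hc : c ∈ A.commutant) :
    c * a = a * c :=
  (VonNeumannAlgebra.mem_commutant_iff.1 hc a ha).symm

/-- The projection onto the closure of a subspace invariant under the commutant of `A`. -/
lemma exists_isProj_of_invariant (V : Submodule ℂ H)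
    (hV : ∀ c ∈ A.commutant, ∀ v ∈ V, c v ∈ V) :
    ∃ s, IsProj A s ∧ (∀ v ∈ V, s v = v) ∧
      ∀ r : H →L[ℂ] H, (∀ v ∈ V, r v = v) → r * s = s := by
  have : CompleteSpace V.topologicalClosure :=
    V.isClosed_topologicalClosure.completeSpace_coe
  have hs : IsStarProjection V.topologicalClosure.starProjection :=
    isStarProjection_starProjection
  refine ⟨V.topologicalClosure.starProjection, ⟨?_, hs.2, hs.1⟩, ?_, ?_⟩
  · rw [VonNeumannAlgebra.IsStarProjection.mem_iff hs]
    intro c hc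
    rw [Submodule.range_starProjection, Module.End.mem_invtSubmodule]
    intro v hv
    exact map_mem_closure c.continuous hv (hV c hc)
  · intro v hv
    exact Submodule.starProjection_eq_self_iff.2 (V.le_topologicalClosure hv)
  · intro r hr
    ext η
    have hcl : IsClosed {v : H | r v = v} := isClosed_eq r.continuous continuous_id
    exact closure_minimal (s := (V : Set H)) hr hcl
      (V.topologicalClosure.starProjection_apply_mem η)

lemma eq_conj_of_mul_eq {a p : H →L[ℂ] H} (ha : IsSelfAdjoint a) (hp : IsSelfAdjoint p)
    (h : p * a = a) : a = p * a * p := by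
  rw [h]
  simpa [ha.star_eq, hp.star_eq] using (congr(star $h)).symm

lemma IsProj.mul_eq_of_eq_conj {a p : H →L[ℂ] H} (hp : IsProj A p) (h : a = p * a * p) :
    p * a = a := by
  rw [h, ← mul_assoc, ← mul_assoc, hp.2.2.eq]

/-- The range projection of an element of `A` belongs to `A`. -/
lemma exists_isProj_mul_eq {a : H →L[ℂ] H} (ha : a ∈ A) :
    ∃ s, IsProj A s ∧ s * a = a ∧ ∀ r : H →L[ℂ] H, r * a = a → r * s = s := by
  obtain ⟨s, hs, h₁, h₂⟩ := exists_isProj_of_invariant (A := A) a.range (by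
    rintro c hc _ ⟨η, rfl⟩
    exact ⟨c η, (congr($(commute_of_mem_commutant ha hc) η)).symm⟩)
  refine ⟨s, hs, ?_, fun r h ↦ h₂ r ?_⟩
  · ext η
    exact h₁ _ ⟨η, rfl⟩
  · rintro _ ⟨η, rfl⟩
    exact congr($h η)

lemma exists_isSupport {a : H →L[ℂ] H} (ha : a ∈ A) (hsa : IsSelfAdjoint a) :
    ∃ p, IsSupport A a p := by
  obtain ⟨s, hs, h₁, h₂⟩ := exists_isProj_mul_eq ha
  refine ⟨s, hs, eq_conj_of_mul_eq hsa hs.2.1 h₁, fun q hq h ↦ ?_⟩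
  rw [hs.isStarProjection.le_iff_mul_eq_right hq.isStarProjection]
  exact h₂ q (hq.mul_eq_of_eq_conj h)

lemma exists_isProjSup {ι : Type*} {q : ι → (H →L[ℂ] H)} (hq : ∀ i, IsProj A (q i)) :
    ∃ s, IsProjSup A q s := by
  obtain ⟨s, hs, h₁, h₂⟩ := exists_isProj_of_invariant (A := A) (⨆ i, (q i).range) (by
    intro c hc
    suffices (⨆ i, (q i).range) ≤ (⨆ i, (q i).range).comap c.toLinearMap from fun v hv ↦ this hv
    refine iSup_le fun i ↦ ?_
    rintro _ ⟨η, rfl⟩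
    refine Submodule.mem_iSup_of_mem i ⟨c η, ?_⟩
    exact (congr($(commute_of_mem_commutant (hq i).1 hc) η)).symm)
  refine ⟨s, hs, fun i ↦ ?_, fun r hr h ↦ ?_⟩
  · rw [(hq i).isStarProjection.le_iff_mul_eq_right hs.isStarProjection]
    ext η
    exact h₁ _ (Submodule.mem_iSup_of_mem i ⟨η, rfl⟩)
  · rw [hs.isStarProjection.le_iff_mul_eq_right hr.isStarProjection]
    apply h₂
    suffices (⨆ i, (q i).range) ≤ (1 - r).ker from fun v hv ↦
      (sub_eq_zero.1 (this hv : v - r v = 0)).symm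
    refine iSup_le fun i ↦ ?_
    rintro _ ⟨η, rfl⟩
    exact sub_eq_zero.2
      congr($(((hq i).isStarProjection.le_iff_mul_eq_right hr.isStarProjection).1 (h i)) η).symm

lemma isSupport_self {p : H →L[ℂ] H} (hp : IsProj A p) : IsSupport A p p := by
  refine ⟨hp, by rw [hp.2.2.eq, hp.2.2.eq], fun q hq h ↦ ?_⟩
  rw [hp.isStarProjection.le_iff_mul_eq_right hq.isStarProjection]
  exact hq.mul_eq_of_eq_conj h

lemma mul_eq_zero_of_nonneg_of_le {x y f : H →L[ℂ] H} (hx : 0 ≤ x) (hxy : x ≤ y)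
    (h : y * f = 0) : x * f = 0 := by
  have h₁ : star f * x * f ≤ 0 := by
    simpa [mul_assoc, h] using star_left_conjugate_le_conjugate hxy f
  have h₂ : star f * x * f = 0 := le_antisymm h₁ (star_left_conjugate_nonneg hx f)
  have h₃ : star (CFC.sqrt x * f) * (CFC.sqrt x * f) = 0 := by
    rw [star_mul, (CFC.sqrt_nonneg x).star_eq, ← h₂]
    simp only [mul_assoc]
    rw [← mul_assoc (CFC.sqrt x), CFC.sqrt_mul_sqrt_self x]
  rw [CStarRing.star_mul_self_eq_zero_iff] at h₃
  rw [← CFC.sqrt_mul_sqrt_self x, mul_assoc, h₃, mul_zero]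

lemma IsSupport.mul_eq_of_le {a p r : H →L[ℂ] H} (hp : IsSupport A a p) (hr : IsProj A r)
    (h : p ≤ r) : r * a = a := by
  rw [← hp.1.mul_eq_of_eq_conj hp.2.1, ← mul_assoc,
    (hp.1.isStarProjection.le_iff_mul_eq_right hr.isStarProjection).1 h]

/-- Supports of positive elements are monotone. -/
lemma IsSupport.le_of_le {x y p q : H →L[ℂ] H} (hp : IsSupport A x p) (hq : IsSupport A y q)
    (hx : 0 ≤ x) (hxy : x ≤ y) : p ≤ q := by
  have hy : q * y = y := hq.1.mul_eq_of_eq_conj hq.2.1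
  have hy' : y * q = y := by
    simpa [((hx.trans hxy)).star_eq, hq.1.2.1.star_eq] using congr(star $hy)
  have hxq : x * q = x := by
    have := mul_eq_zero_of_nonneg_of_le hx hxy (f := 1 - q) (by rw [mul_sub, hy', mul_one, sub_self])
    rw [mul_sub, mul_one, sub_eq_zero] at this
    exact this.symm
  refine hp.2.2 q hq.1 (eq_conj_of_mul_eq hx.isSelfAdjoint hq.1.2.1 ?_)
  simpa [hx.star_eq, hq.1.2.1.star_eq] using congr(star $hxq)

lemma nonneg_of_tendsto {f : ℕ → (H →L[ℂ] H)} {y : H →L[ℂ] H} (hf : ∀ n, 0 ≤ f n)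
    (h : ∀ η, Tendsto (fun n ↦ f n η) atTop (𝓝 (y η))) : 0 ≤ y := by
  rw [nonneg_iff_isPositive, isPositive_iff_complex]
  intro η
  have ht : Tendsto (fun n ↦ inner ℂ (f n η) η) atTop (𝓝 (inner ℂ (y η) η)) :=
    (h η).inner tendsto_const_nhds
  have hre := (Complex.continuous_re.tendsto _).comp ht
  have hf' n := (isPositive_iff_complex (f n)).1 ((nonneg_iff_isPositive _).1 (hf n)) η
  refine ⟨tendsto_nhds_unique ((Complex.continuous_ofReal.tendsto _).comp hre) ?_,
    ge_of_tendsto' hre fun n ↦ (hf' n).2⟩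
  exact ht.congr fun n ↦ (hf' n).1.symm

lemma mem_of_tendsto {f : ℕ → (H →L[ℂ] H)} {y : H →L[ℂ] H} (hf : ∀ n, f n ∈ A)
    (h : ∀ η, Tendsto (fun n ↦ f n η) atTop (𝓝 (y η))) : y ∈ A := by
  refine mem_of_forall_commute fun c hc ↦ ?_
  ext η
  refine tendsto_nhds_unique ((c.continuous.tendsto _).comp (h η)) ?_
  exact (h (c η)).congr fun n ↦ congr($(commute_of_mem_commutant (hf n) hc) η).symm

lemma IsMarkov.map_nonneg (hT : IsMarkov A T) {x : H →L[ℂ] H} (hx : 0 ≤ x) : 0 ≤ T x := by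
  simpa [(CFC.sqrt_nonneg x).star_eq, CFC.sqrt_mul_sqrt_self x] using
    hT.cp 1 (fun _ ↦ CFC.sqrt x) (fun _ ↦ 1)

lemma IsMarkov.iterate_nonneg (hT : IsMarkov A T) {x : H →L[ℂ] H} (hx : 0 ≤ x) (n : ℕ) :
    0 ≤ T^[n] x := by
  induction n with
  | zero => exact hx
  | succ n ih => rw [Function.iterate_succ_apply']; exact hT.map_nonneg ih

lemma IsMarkov.iterate_mem (hT : IsMarkov A T) {x : H →L[ℂ] H} (hx : x ∈ A) (n : ℕ) :
    T^[n] x ∈ A := by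
  induction n with
  | zero => exact hx
  | succ n ih => rw [Function.iterate_succ_apply']; exact hT.mapsSelf _ ih

lemma IsMarkov.iterate_smul_sub (hT : IsMarkov A T) (c : ℂ) (x q : H →L[ℂ] H) (n : ℕ) :
    T^[n] (c • x - q) = c • T^[n] x - T^[n] q := by
  induction n with
  | zero => rfl
  | succ n ih => simp only [Function.iterate_succ_apply', ih, hT.linear.map_sub, hT.linear.map_smul]

lemma SOTSum.nonneg (hT : IsMarkov A T) {x y : H →L[ℂ] H} (hx : 0 ≤ x) (h : SOTSum T x y) :
    0 ≤ y :=
  nonneg_of_tendsto (f := fun N ↦ ∑ n ∈ Finset.range N, T^[n] x)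
    (fun N ↦ Finset.sum_nonneg fun n _ ↦ hT.iterate_nonneg hx n) (by simpa [SOTSum] using h)

lemma SOTSum.map {x y : H →L[ℂ] H} (h : SOTSum T x y) : SOTSum T (T x) (y - x) := by
  intro η
  have := ((h η).comp (tendsto_add_atTop_nat 1)).sub_const (x η)
  simpa [Function.comp_def, Finset.sum_range_succ'] using this

lemma SOTSum.le (hT : IsMarkov A T) {x y : H →L[ℂ] H} (hx : 0 ≤ x) (h : SOTSum T x y) : x ≤ y :=
  sub_nonneg.1 (h.map.nonneg hT (hT.map_nonneg hx))

lemma SOTSum.iterate {x y : H →L[ℂ] H} (h : SOTSum T x y) (N : ℕ) :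
    SOTSum T (T^[N] x) (y - ∑ n ∈ Finset.range N, T^[n] x) := by
  induction N with
  | zero => simpa using h
  | succ N ih =>
    rw [Function.iterate_succ_apply', Finset.sum_range_succ, ← sub_sub]
    exact ih.map

lemma SOTSum.sum_le (hT : IsMarkov A T) {x y : H →L[ℂ] H} (hx : 0 ≤ x) (h : SOTSum T x y)
    (N : ℕ) : ∑ n ∈ Finset.range N, T^[n] x ≤ y :=
  sub_nonneg.1 ((h.iterate N).nonneg hT (hT.iterate_nonneg hx N))

lemma TSummable.iterate (hT : IsMarkov A T) {x : H →L[ℂ] H} (h : TSummable A T x) (n : ℕ) :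
    TSummable A T (T^[n] x) := by
  obtain ⟨hx, hx₀, y, hy, -, hs⟩ := h
  exact ⟨hT.iterate_mem hx n, hT.iterate_nonneg hx₀ n, _,
    sub_mem hy (sum_mem fun k _ ↦ hT.iterate_mem hx k),
    (hs.iterate n).nonneg hT (hT.iterate_nonneg hx₀ n), hs.iterate n⟩

lemma norm_apply_sq_le {D : H →L[ℂ] H} (hD : 0 ≤ D) (η : H) :
    ‖D η‖ ^ 2 ≤ ‖D‖ * D.reApplyInnerSelf η := by
  set R := CFC.sqrt D
  have hR : R * R = D := CFC.sqrt_mul_sqrt_self D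
  have hsa : IsSelfAdjoint R := (CFC.sqrt_nonneg D).isSelfAdjoint
  have h₁ : ‖D‖ = ‖R‖ ^ 2 := by rw [← hR, hsa.norm_mul_self]
  have h₂ : D.reApplyInnerSelf η = ‖R η‖ ^ 2 := by
    rw [reApplyInnerSelf_apply, ← hR, ← inner_self_eq_norm_sq (𝕜 := ℂ)]
    exact congrArg _ (hsa.isSymmetric (R η) η)
  rw [h₁, h₂, ← mul_pow, ← hR]
  gcongr
  exact R.le_opNorm _

/-- A positive element dominated by a multiple of a summable one is summable. -/
lemma TSummable.of_le (hT : IsMarkov A T) {x q : H →L[ℂ] H} (h : TSummable A T x) (hq : q ∈ A)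
    (hq₀ : 0 ≤ q) {c : ℂ} (hqx : q ≤ c • x) : TSummable A T q := by
  obtain ⟨hx, hx₀, y, hy, hy₀, hs⟩ := h
  set S : (H →L[ℂ] H) → ℕ → (H →L[ℂ] H) := fun z N ↦ ∑ n ∈ Finset.range N, T^[n] z with hS
  have hdiff (z : H →L[ℂ] H) {m n : ℕ} (hmn : m ≤ n) :
      S z n - S z m = ∑ k ∈ Finset.Ico m n, T^[k] z := (Finset.sum_Ico_eq_sub _ hmn).symm
  have hnn {m n : ℕ} (hmn : m ≤ n) : 0 ≤ S q n - S q m := by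
    rw [hdiff q hmn]
    exact Finset.sum_nonneg fun k _ ↦ hT.iterate_nonneg hq₀ k
  have hle {m n : ℕ} (hmn : m ≤ n) : S q n - S q m ≤ c • (S x n - S x m) := by
    rw [hdiff q hmn, hdiff x hmn, Finset.smul_sum]
    refine Finset.sum_le_sum fun k _ ↦ sub_nonneg.1 ?_
    rw [← hT.iterate_smul_sub]
    exact hT.iterate_nonneg (sub_nonneg.2 hqx) k
  have hnorm {m n : ℕ} (hmn : m ≤ n) : ‖S q n - S q m‖ ≤ ‖c‖ * ‖y‖ := by
    have h₀ : S q 0 = 0 ∧ S x 0 = 0 := by simp [hS]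
    have h₁ : S q n - S q m ≤ S q n := by
      have := hnn m.zero_le
      rw [h₀.1, sub_zero] at this
      exact sub_le_self _ this
    have h₂ : S q n ≤ c • S x n := by simpa [h₀] using hle n.zero_le
    refine (CStarAlgebra.norm_le_norm_of_nonneg_of_le (hnn hmn) (h₁.trans h₂)).trans ?_
    rw [norm_smul]
    gcongr
    exact CStarAlgebra.norm_le_norm_of_nonneg_of_le
      (Finset.sum_nonneg fun k _ ↦ hT.iterate_nonneg hx₀ k) (hs.sum_le hT hx₀ n)
  have key (η : H) {m n : ℕ} (hmn : m ≤ n) :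
      ‖S q n η - S q m η‖ ^ 2 ≤ ‖c‖ * ‖y‖ * (‖c‖ * ‖η‖) * ‖S x n η - S x m η‖ := by
    refine (norm_apply_sq_le (hnn hmn) η).trans ?_
    have h₁ : (S q n - S q m).reApplyInnerSelf η ≤ ‖c‖ * ‖η‖ * ‖S x n η - S x m η‖ := by
      have h₂ := ((le_def _ _).1 (hle hmn)).re_inner_nonneg_left η
      rw [sub_apply, inner_sub_left, map_sub, sub_nonneg] at h₂
      refine h₂.trans ((Complex.re_le_norm _).trans ((norm_inner_le_norm _ _).trans ?_))
      rw [smul_apply, norm_smul, sub_apply]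
      exact le_of_eq (by ring)
    calc _ ≤ (‖c‖ * ‖y‖) * (‖c‖ * ‖η‖ * ‖S x n η - S x m η‖) := by
          have := ((nonneg_iff_isPositive _).1 (hnn hmn)).re_inner_nonneg_left η
          exact mul_le_mul (hnorm hmn) h₁ this (by positivity)
      _ = _ := by ring
  have hsx (η : H) : Tendsto (fun N ↦ S x N η) atTop (𝓝 (y η)) := by simpa [hS] using hs η
  have hcau (η : H) : CauchySeq fun N ↦ S q N η := by
    rw [Metric.cauchySeq_iff']
    intro ε hε
    set K := ‖c‖ * ‖y‖ * (‖c‖ * ‖η‖)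
    have hK : 0 ≤ K := by positivity
    obtain ⟨N, hN⟩ := Metric.cauchySeq_iff'.1 (hsx η).cauchySeq (ε ^ 2 / (K + 1)) (by positivity)
    refine ⟨N, fun n hn ↦ ?_⟩
    have h₁ := hN n hn
    rw [dist_eq_norm, lt_div_iff₀ (by positivity)] at h₁
    rw [dist_eq_norm]
    refine lt_of_pow_lt_pow_left₀ 2 hε.le ((key η hn).trans_lt ?_)
    nlinarith [norm_nonneg (S x n η - S x N η)]
  choose f hf using fun η ↦ cauchySeq_tendsto_of_complete (hcau η)
  have hz (η : H) : Tendsto (fun N ↦ S q N η) atTop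
      (𝓝 (continuousLinearMapOfTendsto (S q) (tendsto_pi_nhds.2 hf) η)) := hf η
  have hsum : SOTSum T q (continuousLinearMapOfTendsto (S q) (tendsto_pi_nhds.2 hf)) := by
    intro η
    simpa [hS] using hz η
  exact ⟨hq, hq₀, _, mem_of_tendsto (fun N ↦ sum_mem fun k _ ↦ hT.iterate_mem hq k) hz,
    hsum.nonneg hT hq₀, hsum⟩

/-- Spectral cut-off of a positive element of `A`. -/
lemma exists_isProj_smul_le {x : H →L[ℂ] H} (hx : x ∈ A) (hx₀ : 0 ≤ x) {ε : ℝ} (hε : 0 < ε) :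
    ∃ e a : H →L[ℂ] H, IsProj A e ∧ ε • e ≤ x ∧ e * a = a ∧ ‖x - a‖ ≤ ε := by
  have hsx : IsSelfAdjoint x := hx₀.isSelfAdjoint
  set a := cfc (fun t : ℝ ↦ max (t - ε) 0) x with ha
  set n := cfc (fun t : ℝ ↦ max (ε - t) 0) x with hn
  have ha₀ : 0 ≤ a := cfc_nonneg fun t _ ↦ le_max_right _ _
  have hn₀ : 0 ≤ n := cfc_nonneg fun t _ ↦ le_max_right _ _
  have haA : a ∈ A := mem_of_forall_commute fun c hc ↦
    ((show Commute x c from (commute_of_mem_commutant hx hc).symm).cfc_real _).symm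
  have hna : n * a = 0 := by
    rw [ha, hn, ← cfc_mul _ _ x (by fun_prop) (by fun_prop), ← cfc_zero ℝ x]
    refine cfc_congr fun t _ ↦ ?_
    rcases le_total t ε with h | h <;> simp [h]
  have hxn : x = ε • 1 + a - n := by
    have h₁ : a - n = cfc (fun t : ℝ ↦ t - ε) x := by
      rw [ha, hn, ← cfc_sub _ _ x (by fun_prop) (by fun_prop)]
      refine cfc_congr fun t _ ↦ ?_
      rcases le_total t ε with h | h <;> simp [h]
    rw [add_sub_assoc, h₁, cfc_sub _ _ x (by fun_prop) (by fun_prop), cfc_id' ℝ x,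
      cfc_const ε x, Algebra.algebraMap_eq_smul_one]
    abel
  obtain ⟨e, he, hea, hmin⟩ := exists_isProj_mul_eq haA
  have hne : n * e = 0 := by
    simpa [sub_mul] using hmin (1 - n) (by rw [sub_mul, hna, one_mul, sub_zero])
  have hen : e * n = 0 := by simpa [hn₀.star_eq, he.2.1.star_eq] using congr(star $hne)
  have hae : a * e = a := by
    simpa [ha₀.star_eq, he.2.1.star_eq] using congr(star $hea)
  have hex : e * x = ε • e + a := by
    rw [hxn, mul_sub, mul_add, hen, hea, sub_zero, mul_smul_comm, mul_one]
  have hxe : x * e = ε • e + a := by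
    rw [hxn, sub_mul, add_mul, hne, hae, sub_zero, smul_mul_assoc, one_mul]
  have hexe : e * x * e = ε • e + a := by
    rw [hex, add_mul, smul_mul_assoc, he.2.2.eq, hae]
  refine ⟨e, a, he, sub_nonneg.1 ?_, hea, ?_⟩
  · have h₁ : x - ε • e = a + star (1 - e) * x * (1 - e) := by
      rw [star_sub, star_one, he.2.1.star_eq, sub_mul, one_mul, hex, mul_sub, mul_one, sub_mul,
        ← hex, hexe, hxe, hex]
      abel
    rw [h₁]
    exact add_nonneg ha₀ (star_left_conjugate_nonneg hx₀ _)
  · have h₁ : x - a = cfc (fun t : ℝ ↦ t - max (t - ε) 0) x := by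
      rw [ha, cfc_sub _ _ x (by fun_prop) (by fun_prop), cfc_id' ℝ x]
    rw [h₁]
    refine norm_cfc_le hε.le fun t ht ↦ ?_
    have ht₀ : 0 ≤ t := spectrum_nonneg_of_nonneg hx₀ ht
    rw [Real.norm_eq_abs, abs_le]
    rcases le_total t ε with h | h
    · rw [max_eq_right (by linarith)]
      constructor <;> linarith
    · rw [max_eq_left (by linarith)]
      constructor <;> linarith

end

end QMP

open QMP

/-- Characterizations of transient projections: domination by a supremum of supports of
potentials, of supports of `T`-summable positive elements, or of `T`-summable projections,
are all equivalent. -/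
theorem transient_tfae
    {H : Type*} [NormedAddCommGroup H] [InnerProductSpace ℂ H] [CompleteSpace H]
    (A : VonNeumannAlgebra H) (T : (H →L[ℂ] H) → (H →L[ℂ] H)) (hT : IsMarkov A T)
    (p : H →L[ℂ] H) (hp : IsProj A p) :
    ((∃ (ι : Type) (y q : ι → (H →L[ℂ] H)) (s : H →L[ℂ] H),
        (∀ i, IsPotential A T (y i) ∧ IsSupport A (y i) (q i)) ∧ IsProjSup A q s ∧ p ≤ s) ↔
      (∃ (ι : Type) (x q : ι → (H →L[ℂ] H)) (s : H →L[ℂ] H),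
        (∀ i, TSummable A T (x i) ∧ IsSupport A (x i) (q i)) ∧ IsProjSup A q s ∧ p ≤ s)) ∧
    ((∃ (ι : Type) (x q : ι → (H →L[ℂ] H)) (s : H →L[ℂ] H),
        (∀ i, TSummable A T (x i) ∧ IsSupport A (x i) (q i)) ∧ IsProjSup A q s ∧ p ≤ s) ↔
      (∃ (ι : Type) (q : ι → (H →L[ℂ] H)) (s : H →L[ℂ] H),
        (∀ i, IsProj A (q i) ∧ TSummable A T (q i)) ∧ IsProjSup A q s ∧ p ≤ s)) := by
  refine ⟨⟨?_, ?_⟩, ⟨?_, ?_⟩⟩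
  · rintro ⟨ι, y, q, s, h, hs, hps⟩
    choose x hx hx₀ hxy using fun i ↦ (h i).1.2.2
    have hsum (k : ι × ℕ) : TSummable A T (T^[k.2] (x k.1)) :=
      TSummable.iterate hT ⟨hx _, hx₀ _, y k.1, (h k.1).1.1, (h k.1).1.2.1, hxy _⟩ k.2
    choose e he using fun k ↦ exists_isSupport (hsum k).1 (hsum k).2.1.isSelfAdjoint
    obtain ⟨s', hs'⟩ := exists_isProjSup fun k ↦ (he k).1
    refine ⟨ι × ℕ, _, e, s', fun k ↦ ⟨hsum k, he k⟩, hs', hps.trans (hs.2.2 s' hs'.1 fun i ↦ ?_)⟩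
    refine (h i).2.2.2 s' hs'.1
      (eq_conj_of_mul_eq (h i).1.2.1.isSelfAdjoint hs'.1.2.1 ?_)
    ext η
    refine tendsto_nhds_unique ((s'.continuous.tendsto _).comp (hxy i η)) ((hxy i η).congr ?_)
    intro N
    simp only [Function.comp_apply, map_sum]
    exact Finset.sum_congr rfl fun n _ ↦
      congr($((he (i, n)).mul_eq_of_le hs'.1 (hs'.2.1 (i, n))) η).symm
  · rintro ⟨ι, x, q, s, h, hs, hps⟩
    choose y hy hy₀ hxy using fun i ↦ (h i).1.2.2
    choose e he using fun i ↦ exists_isSupport (hy i) (hy₀ i).isSelfAdjoint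
    obtain ⟨s', hs'⟩ := exists_isProjSup fun i ↦ (he i).1
    refine ⟨ι, y, e, s', fun i ↦ ⟨⟨hy i, hy₀ i, x i, (h i).1.1, (h i).1.2.1, hxy i⟩, he i⟩, hs',
      hps.trans (hs.2.2 s' hs'.1 fun i ↦ le_trans ?_ (hs'.2.1 i))⟩
    exact (h i).2.le_of_le (he i) (h i).1.2.1 ((hxy i).le hT (h i).1.2.1)
  · rintro ⟨ι, x, q, s, h, hs, hps⟩
    have hε (n : ℕ) : (0 : ℝ) < 1 / (n + 1) := Nat.one_div_pos_of_nat
    choose e a he hle hea hxa using fun k : ι × ℕ ↦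
      exists_isProj_smul_le (h k.1).1.1 (h k.1).1.2.1 (hε k.2)
    obtain ⟨s', hs'⟩ := exists_isProjSup he
    refine ⟨ι × ℕ, e, s', fun k ↦ ⟨he k, ?_⟩, hs', hps.trans (hs.2.2 s' hs'.1 fun i ↦ ?_)⟩
    · refine (h k.1).1.of_le hT (he k).1 (he k).isStarProjection.nonneg
        (c := (((k.2 : ℝ) + 1 : ℝ) : ℂ)) ?_
      have := smul_le_smul_of_nonneg_left (hle k) (by positivity : (0 : ℝ) ≤ (k.2 : ℝ) + 1)
      rw [smul_smul, mul_one_div_cancel (by positivity), one_smul] at this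
      rwa [Complex.coe_smul]
    · refine (h i).2.2.2 s' hs'.1
        (eq_conj_of_mul_eq (h i).1.2.1.isSelfAdjoint hs'.1.2.1 ?_)
      have hlim : Tendsto (fun n ↦ a (i, n)) atTop (𝓝 (x i)) := by
        rw [tendsto_iff_norm_sub_tendsto_zero]
        refine squeeze_zero (fun _ ↦ norm_nonneg _) (fun n ↦ ?_)
          (tendsto_one_div_add_atTop_nhds_zero_nat (𝕜 := ℝ))
        rw [norm_sub_rev]
        exact hxa (i, n)
      refine tendsto_nhds_unique (hlim.const_mul s') (hlim.congr fun n ↦ ?_)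
      have hse := ((he (i, n)).isStarProjection.le_iff_mul_eq_right hs'.1.isStarProjection).1
        (hs'.2.1 (i, n))
      rw [← hea (i, n), ← mul_assoc, hse]
  · rintro ⟨ι, q, s, h, hs, hps⟩
    exact ⟨ι, q, q, s, fun i ↦ ⟨(h i).2, isSupport_self (h i).1⟩, hs, hps⟩
end

section
/- For a Markov operator T on a von Neumann algebra A, the maximal transient projection p_Tr is zero if and only if every superharmonic element a ∈ A₊ (T(a) ≤ a) is a fixed point of T. -/
open Filter Topology ContinuousLinearMap

open QMP

namespace QMP

section Order

open scoped ComplexOrder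

variable {H : Type*} [NormedAddCommGroup H] [InnerProductSpace ℂ H]

theorem le_iff_forall_inner_nonneg {x y : H →L[ℂ] H} :
    x ≤ y ↔ ∀ η : H, 0 ≤ inner ℂ ((y - x) η) η := by
  rw [ContinuousLinearMap.le_def, isPositive_iff]
  refine ⟨fun h => h.2, fun h => ⟨?_, h⟩⟩
  exact ((isPositive_iff_complex _).2 fun η => by
    have := h η
    rw [Complex.le_def] at this
    refine ⟨?_, this.1⟩
    exact Complex.ext rfl this.2).isSymmetric

theorem smul_nonneg_of_nonneg {c : ℝ} (hc : 0 ≤ c) {x : H →L[ℂ] H} (hx : 0 ≤ x) :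
    0 ≤ (c : ℂ) • x := by
  rw [nonneg_iff_isPositive] at hx ⊢
  exact hx.smul_of_nonneg (by exact_mod_cast hc)

theorem le_of_tendsto_apply {S : ℕ → H →L[ℂ] H} {y b : H →L[ℂ] H}
    (hy : ∀ η, Tendsto (fun n => S n η) atTop (𝓝 (y η))) (hb : ∀ n, S n ≤ b) : y ≤ b := by
  rw [le_iff_forall_inner_nonneg]
  intro η
  have h : Tendsto (fun n => inner ℂ ((b - S n) η) η) atTop (𝓝 (inner ℂ ((b - y) η) η)) :=
    (tendsto_const_nhds.sub (hy η)).inner tendsto_const_nhds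
  exact ge_of_tendsto' h fun n => le_iff_forall_inner_nonneg.1 (hb n) η

theorem ge_of_monotone_of_tendsto_apply {S : ℕ → H →L[ℂ] H} {y : H →L[ℂ] H}
    (hS : Monotone S) (hy : ∀ η, Tendsto (fun n => S n η) atTop (𝓝 (y η))) (m : ℕ) :
    S m ≤ y := by
  rw [le_iff_forall_inner_nonneg]
  intro η
  have h : Tendsto (fun n => inner ℂ ((S n - S m) η) η) atTop (𝓝 (inner ℂ ((y - S m) η) η)) :=
    ((hy η).sub tendsto_const_nhds).inner tendsto_const_nhds
  exact ge_of_tendsto h ((eventually_ge_atTop m).mono fun n hn =>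
    le_iff_forall_inner_nonneg.1 (hS hn) η)

theorem isLUB_of_tendsto_apply {S : ℕ → H →L[ℂ] H} {y : H →L[ℂ] H}
    (hS : Monotone S) (hy : ∀ η, Tendsto (fun n => S n η) atTop (𝓝 (y η))) :
    IsLUB (Set.range S) y :=
  ⟨by rintro _ ⟨m, rfl⟩; exact ge_of_monotone_of_tendsto_apply hS hy m,
    fun _ hb => le_of_tendsto_apply hy fun n => hb ⟨n, rfl⟩⟩

variable [CompleteSpace H]

theorem smul_le_smul_of_le {c : ℝ} (hc : 0 ≤ c) {x y : H →L[ℂ] H} (hxy : x ≤ y) :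
    (c : ℂ) • x ≤ (c : ℂ) • y := by
  rw [← sub_nonneg, ← smul_sub]
  exact smul_nonneg_of_nonneg hc (sub_nonneg.2 hxy)

theorem norm_sq_apply_le_of_nonneg {d : H →L[ℂ] H} (hd : 0 ≤ d) (η : H) :
    ‖d η‖ ^ 2 ≤ ‖d‖ * (inner ℂ (d η) η).re := by
  obtain ⟨c, rfl⟩ := CStarAlgebra.nonneg_iff_eq_star_mul_self.mp hd
  have h1 : (inner ℂ ((star c * c) η) η).re = ‖c η‖ ^ 2 := by
    rw [mul_apply_eq_comp, star_eq_adjoint, adjoint_inner_left]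
    exact inner_self_eq_norm_sq (𝕜 := ℂ) (c η)
  rw [h1, CStarRing.norm_star_mul_self, mul_apply_eq_comp, ← norm_star c,
    ← sq, ← mul_pow]
  exact pow_le_pow_left₀ (norm_nonneg _) ((star c).le_opNorm _) 2

/-- A bounded increasing sequence of positive operators converges strongly. -/
theorem exists_tendsto_of_monotone {S : ℕ → H →L[ℂ] H} (hS : Monotone S) (h0 : ∀ n, 0 ≤ S n)
    {b : H →L[ℂ] H} (hb : ∀ n, S n ≤ b) :
    ∃ y : H →L[ℂ] H, ∀ η, Tendsto (fun n => S n η) atTop (𝓝 (y η)) := by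
  have key : ∀ η, ∃ z, Tendsto (fun n => S n η) atTop (𝓝 z) := by
    intro η
    have hle : ∀ {x y : H →L[ℂ] H}, x ≤ y → (inner ℂ (x η) η).re ≤ (inner ℂ (y η) η).re := by
      intro x y h
      have := (Complex.le_def.1 (le_iff_forall_inner_nonneg.1 h η)).1
      simpa [inner_sub_left] using this
    have hconv := tendsto_atTop_ciSup (f := fun n => (inner ℂ (S n η) η).re)
      (fun m n h => hle (hS h)) ⟨_, by rintro _ ⟨n, rfl⟩; exact hle (hb n)⟩
    have hbound : ∀ m n, m ≤ n → ‖S n η - S m η‖ ^ 2 ≤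
        ‖b‖ * ((inner ℂ (S n η) η).re - (inner ℂ (S m η) η).re) := by
      intro m n h
      have hd : 0 ≤ S n - S m := sub_nonneg.2 (hS h)
      have h1 := norm_sq_apply_le_of_nonneg hd η
      have h2 : ‖S n - S m‖ ≤ ‖b‖ := CStarAlgebra.norm_le_norm_of_nonneg_of_le hd
        ((sub_le_self _ (h0 m)).trans (hb n))
      have h3 := hle (hS h)
      simp only [sub_apply, inner_sub_left, Complex.sub_re] at h1
      exact h1.trans (mul_le_mul_of_nonneg_right h2 (sub_nonneg.2 h3))
    refine cauchySeq_tendsto_of_complete (Metric.cauchySeq_iff'.2 fun ε hε => ?_)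
    have hB : 0 < ‖b‖ + 1 := by positivity
    obtain ⟨N, hN⟩ := Metric.cauchySeq_iff'.1 hconv.cauchySeq (ε ^ 2 / (‖b‖ + 1)) (by positivity)
    refine ⟨N, fun n hn => ?_⟩
    have h1 := hN n hn
    rw [Real.dist_eq, lt_div_iff₀ hB] at h1
    rw [dist_eq_norm]
    refine lt_of_pow_lt_pow_left₀ 2 hε.le ((hbound N n hn).trans_lt ?_)
    have h3 := le_abs_self ((inner ℂ (S n η) η).re - (inner ℂ (S N η) η).re)
    have h4 := abs_nonneg ((inner ℂ (S n η) η).re - (inner ℂ (S N η) η).re)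
    nlinarith [norm_nonneg b]
  choose f hf using key
  exact ⟨continuousLinearMapOfTendsto S (tendsto_pi_nhds.2 hf), hf⟩

theorem mem_of_commute_commutant {A : VonNeumannAlgebra H} {x : H →L[ℂ] H}
    (h : ∀ z ∈ A.commutant, z * x = x * z) : x ∈ A := by
  rw [← A.commutant_commutant, VonNeumannAlgebra.mem_commutant_iff]
  exact h

theorem mem_of_tendsto_apply {A : VonNeumannAlgebra H} {S : ℕ → H →L[ℂ] H} {y : H →L[ℂ] H}
    (hS : ∀ n, S n ∈ A) (hy : ∀ η, Tendsto (fun n => S n η) atTop (𝓝 (y η))) : y ∈ A := by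
  refine mem_of_commute_commutant fun z hz => ?_
  ext η
  have h1 : Tendsto (fun n => z (S n η)) atTop (𝓝 (z (y η))) :=
    (z.continuous.tendsto _).comp (hy η)
  refine tendsto_nhds_unique h1 ((hy (z η)).congr fun n => ?_)
  exact congr($(VonNeumannAlgebra.mem_commutant_iff.1 hz _ (hS n)) η)

/-- A nonzero positive element of a von Neumann algebra dominates a positive multiple of a nonzero
projection of the algebra. -/
theorem exists_isProj_smul_le_s12 {A : VonNeumannAlgebra H} {x : H →L[ℂ] H} (hx : x ∈ A)
    (h0 : 0 ≤ x) (hne : x ≠ 0) :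
    ∃ (p : H →L[ℂ] H) (ε : ℝ), IsProj A p ∧ p ≠ 0 ∧ 0 < ε ∧ (ε : ℂ) • p ≤ x := by
  set ε : ℝ := ‖x‖ / 2 with hε
  have hnorm : 0 < ‖x‖ := norm_pos_iff.2 hne
  have hεpos : 0 < ε := by positivity
  have hxsa : IsSelfAdjoint x := .of_nonneg h0
  set d : H →L[ℂ] H := x - algebraMap ℝ _ ε with hd
  have hdsa : IsSelfAdjoint d := hxsa.sub (.algebraMap _ (.all ε))
  set f : H →L[ℂ] H := d⁺ with hf
  have hf0 : 0 ≤ f := CFC.posPart_nonneg d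
  have hfne : f ≠ 0 := by
    intro h
    rw [hf, CFC.posPart_eq_zero_iff d hdsa, hd, sub_nonpos,
      ← CStarAlgebra.norm_le_iff_le_algebraMap x hεpos.le h0] at h
    linarith
  have hdf : d * f = f * f := by
    conv_lhs => rw [← CFC.posPart_sub_negPart d hdsa]
    rw [sub_mul, hf, CFC.negPart_mul_posPart, sub_zero]
  have hcomm : ∀ z, Commute x z → Commute f z := fun z hz =>
    (hz.sub_left (Algebra.commutes ε z)).cfcₙ_real _
  let K : Submodule ℂ H := f.range.topologicalClosure
  have : CompleteSpace K := f.range.isClosed_topologicalClosure.completeSpace_coe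
  have hKinv : ∀ z, Commute x z → ∀ η ∈ K, z η ∈ K := by
    intro z hz η hη
    refine map_mem_closure z.continuous hη ?_
    rintro _ ⟨ξ, rfl⟩
    exact ⟨z ξ, congr($(hcomm z hz) ξ)⟩
  have hpos : ∀ η ∈ K, 0 ≤ inner ℂ (d η) η := by
    intro η hη
    refine closure_minimal (t := {η | 0 ≤ inner ℂ (d η) η}) ?_ (isClosed_le continuous_const
      (d.continuous.inner continuous_id)) hη
    rintro _ ⟨ξ, rfl⟩
    have h1 : d (f ξ) = f (f ξ) := congr($hdf ξ)
    change 0 ≤ inner ℂ (d (f ξ)) (f ξ)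
    rw [h1]
    exact ((nonneg_iff_isPositive f).1 hf0).inner_nonneg_left _
  have hproj : IsStarProjection K.starProjection := isStarProjection_starProjection
  refine ⟨K.starProjection, ε, ⟨?_, hproj.isSelfAdjoint, hproj.isIdempotentElem⟩, ?_, hεpos, ?_⟩
  · rw [VonNeumannAlgebra.IsStarProjection.mem_iff hproj]
    intro z hz
    rw [Submodule.range_starProjection]
    exact hKinv z (VonNeumannAlgebra.mem_commutant_iff.1 hz x hx)
  · intro h
    refine hfne (ContinuousLinearMap.ext fun ξ => ?_)
    have hmem : f ξ ∈ K := f.range.le_topologicalClosure ⟨ξ, rfl⟩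
    rw [← Submodule.starProjection_eq_self_iff.2 hmem, h]
    rfl
  · rw [le_iff_forall_inner_nonneg]
    intro η
    set u := K.starProjection η with hu
    set v := η - u with hv
    have huK : u ∈ K := K.starProjection_apply_mem η
    have hvK : v ∈ Kᗮ := K.sub_starProjection_mem_orthogonal η
    have hη : η = u + v := by simp [hv]
    have hxu : inner ℂ (x u) v = 0 := Submodule.inner_right_of_mem_orthogonal
      (hKinv x (Commute.refl x) u huK) hvK
    have hxv : inner ℂ (x v) u = 0 := by
      rw [((nonneg_iff_isPositive x).1 h0).inner_left_eq_inner_right]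
      exact Submodule.inner_left_of_mem_orthogonal (hKinv x (Commute.refl x) u huK) hvK
    have huv : inner ℂ u v = 0 := Submodule.inner_right_of_mem_orthogonal huK hvK
    have hdu : d u = x u - (ε : ℂ) • u := by
      simp [hd, Algebra.algebraMap_eq_smul_one]
    have hsplit : inner ℂ ((x - (ε : ℂ) • K.starProjection) η) η =
        inner ℂ (d u) u + inner ℂ (x v) v := by
      have h1 : (x - (ε : ℂ) • K.starProjection) η = d u + x v := by
        rw [hdu, sub_apply, smul_apply, ← hu]
        conv_lhs => rw [hη, map_add]
        abel
      have h2 : inner ℂ (d u) v = 0 := by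
        rw [hdu, inner_sub_left, hxu, inner_smul_left, huv]; simp
      rw [h1]
      conv_lhs => rw [hη]
      simp only [inner_add_left, inner_add_right, h2, hxv]
      ring
    rw [hsplit]
    exact add_nonneg (hpos u huK) (((nonneg_iff_isPositive x).1 h0).inner_nonneg_left v)

theorem smul_mem_vonNeumannAlgebra {A : VonNeumannAlgebra H} (c : ℂ) {x : H →L[ℂ] H}
    (hx : x ∈ A) : c • x ∈ A :=
  show c • x ∈ A.toStarSubalgebra from A.toStarSubalgebra.smul_mem hx c

theorem IsProj.nonneg {A : VonNeumannAlgebra H} {p : H →L[ℂ] H} (hp : IsProj A p) : 0 ≤ p :=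
  IsStarProjection.nonneg ⟨hp.2.2, hp.2.1⟩

end Order

namespace IsMarkov

variable {H : Type*} [NormedAddCommGroup H] [InnerProductSpace ℂ H] [CompleteSpace H]
  {A : VonNeumannAlgebra H} {T : (H →L[ℂ] H) → (H →L[ℂ] H)}

theorem map_nonneg_s12 (hT : IsMarkov A T) {x : H →L[ℂ] H} (hx : 0 ≤ x) : 0 ≤ T x := by
  obtain ⟨c, rfl⟩ := CStarAlgebra.nonneg_iff_eq_star_mul_self.mp hx
  simpa using hT.cp 1 (fun _ => c) (fun _ => 1)

theorem monotone (hT : IsMarkov A T) : Monotone T := by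
  intro x y h
  have := hT.map_nonneg_s12 (sub_nonneg.2 h)
  rwa [hT.linear.map_sub, sub_nonneg] at this

theorem iterate_nonneg_s12 (hT : IsMarkov A T) {x : H →L[ℂ] H} (hx : 0 ≤ x) (n : ℕ) :
    0 ≤ T^[n] x := by
  induction n with
  | zero => exact hx
  | succ n ih => rw [Function.iterate_succ_apply']; exact hT.map_nonneg_s12 ih

theorem iterate_mem_s12 (hT : IsMarkov A T) {x : H →L[ℂ] H} (hx : x ∈ A) (n : ℕ) :
    T^[n] x ∈ A := by
  induction n with
  | zero => exact hx
  | succ n ih => rw [Function.iterate_succ_apply']; exact hT.mapsSelf _ ih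

theorem map_sum_range (hT : IsMarkov A T) (x : H →L[ℂ] H) (N : ℕ) :
    T (∑ n ∈ Finset.range N, T^[n] x) = ∑ n ∈ Finset.range (N + 1), T^[n] x - x := by
  have h := map_sum (hT.linear.mk' T) (fun n => T^[n] x) (Finset.range N)
  rw [IsLinearMap.mk'_apply] at h
  rw [h, Finset.sum_range_succ']
  simp [Function.iterate_succ_apply']

theorem sum_range_sub_map (hT : IsMarkov A T) (a : H →L[ℂ] H) (N : ℕ) :
    ∑ n ∈ Finset.range N, T^[n] (a - T a) = a - T^[N] a := by
  refine Eq.trans ?_ (Finset.sum_range_sub' (fun n => T^[n] a) N)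
  refine Finset.sum_congr rfl fun n _ => ?_
  rw [Function.iterate_succ_apply]
  exact iterate_map_sub (hT.linear.mk' T) n a (T a)

theorem monotone_sum_range (hT : IsMarkov A T) {x : H →L[ℂ] H} (hx : 0 ≤ x) :
    Monotone fun N => ∑ n ∈ Finset.range N, T^[n] x :=
  monotone_nat_of_le_succ fun N => by
    rw [Finset.sum_range_succ]
    exact le_add_of_nonneg_right (hT.iterate_nonneg_s12 hx N)

/-- A positive element whose partial sums are bounded is summable. -/
theorem tSummable_of_bounded (hT : IsMarkov A T) {x b : H →L[ℂ] H} (hxA : x ∈ A) (hx : 0 ≤ x)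
    (hb : ∀ N, ∑ n ∈ Finset.range N, T^[n] x ≤ b) : TSummable A T x := by
  have hmono := hT.monotone_sum_range hx
  obtain ⟨y, hy⟩ := exists_tendsto_of_monotone hmono
    (fun N => Finset.sum_nonneg fun n _ => hT.iterate_nonneg_s12 hx n) hb
  refine ⟨hxA, hx, y, mem_of_tendsto_apply
    (fun N => sum_mem fun n _ => hT.iterate_mem_s12 hxA n) hy, ?_, fun η => ?_⟩
  · simpa using ge_of_monotone_of_tendsto_apply hmono hy 0
  · simpa [sum_apply] using hy η

/-- A potential `y = ∑ₙ Tⁿ x` satisfies `T y = y - x`. -/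
theorem map_eq_sub_of_sotSum (hT : IsMarkov A T) {x y : H →L[ℂ] H} (hx : 0 ≤ x)
    (hy : SOTSum T x y) : T y = y - x := by
  have hmono := hT.monotone_sum_range hx
  have hy' : ∀ η, Tendsto (fun N => (∑ n ∈ Finset.range N, T^[n] x) η) atTop (𝓝 (y η)) :=
    fun η => by simpa [sum_apply] using hy η
  refine (hT.normal _ y hmono (isLUB_of_tendsto_apply hmono hy')).unique
    (isLUB_of_tendsto_apply (hT.monotone.comp hmono) fun η => ?_)
  simp only [hT.map_sum_range]
  exact ((hy' η).comp (tendsto_add_atTop_nat 1)).sub tendsto_const_nhds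

theorem tSummable_of_smul_le (hT : IsMarkov A T) {a p : H →L[ℂ] H} {ε : ℝ} (ha : 0 ≤ a)
    (hpA : p ∈ A) (hp : 0 ≤ p) (hε : 0 < ε) (hle : (ε : ℂ) • p ≤ a - T a) :
    TSummable A T p := by
  set a' : H →L[ℂ] H := ((ε⁻¹ : ℝ) : ℂ) • a with ha'
  have hle' : p ≤ a' - T a' := by
    have h := smul_le_smul_of_le (inv_nonneg.2 hε.le) hle
    have hne : (ε : ℂ) ≠ 0 := by exact_mod_cast hε.ne'
    rwa [smul_smul, Complex.ofReal_inv, inv_mul_cancel₀ hne, one_smul, smul_sub,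
      ← Complex.ofReal_inv, ← hT.linear.map_smul] at h
  refine hT.tSummable_of_bounded (b := a') hpA hp fun N => ?_
  calc ∑ n ∈ Finset.range N, T^[n] p ≤ ∑ n ∈ Finset.range N, T^[n] (a' - T a') :=
        Finset.sum_le_sum fun n _ => hT.monotone.iterate n hle'
    _ = a' - T^[N] a' := hT.sum_range_sub_map a' N
    _ ≤ a' := sub_le_self _
        (hT.iterate_nonneg_s12 (smul_nonneg_of_nonneg (inv_nonneg.2 hε.le) ha) N)

end IsMarkov

end QMP

/-- The maximal transient projection vanishes iff every superharmonic positive element of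
`A` is a fixed point of `T`. -/
theorem maxTransient_eq_zero_iff_superharmonic_fixed
    {H : Type*} [NormedAddCommGroup H] [InnerProductSpace ℂ H] [CompleteSpace H]
    (A : VonNeumannAlgebra H) (T : (H →L[ℂ] H) → (H →L[ℂ] H)) (hT : IsMarkov A T)
    (e : H →L[ℂ] H) (he : IsMaxTransient A T e) :
    e = 0 ↔ ∀ a ∈ A, 0 ≤ a → T a ≤ a → T a = a := by
  constructor
  · rintro rfl a haA ha hle
    by_contra hne
    obtain ⟨p, ε, hp, hp0, hε, hpx⟩ := exists_isProj_smul_le_s12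
      (sub_mem haA (hT.mapsSelf a haA)) (sub_nonneg.2 hle)
      (sub_ne_zero.2 (Ne.symm hne))
    refine hp0 (le_antisymm (he.2.1 p hp ?_) hp.nonneg)
    exact ⟨Unit, fun _ => p, p,
      fun _ => ⟨hp, hT.tSummable_of_smul_le ha hp.1 hp.nonneg hε hpx⟩,
      ⟨hp, fun _ => le_rfl, fun _ _ h => h ()⟩, le_rfl⟩
  · intro h
    have h0 : IsProj A (0 : H →L[ℂ] H) := ⟨zero_mem A, .zero _, .zero⟩
    refine le_antisymm (he.2.2 0 h0 ?_) he.1.nonneg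
    rintro p - ⟨ι, q, s, hq, hs, hps⟩
    refine hps.trans (hs.2.2 0 h0 fun i => ?_)
    obtain ⟨-, -, hqi, y, hyA, hy, hsum⟩ := hq i
    have hTy := hT.map_eq_sub_of_sotSum hqi hsum
    have hfix := h y hyA hy (hTy ▸ sub_le_self y hqi)
    rw [hTy, sub_eq_self] at hfix
    exact hfix.le
end

section
/- Let A be a finite dimensional von Neumann algebra and T : A → A a Markov operator with maximal positive recurrent projection p_R (the supremum of supports of stationary states). Then p_R^⊥ is T-summable; in fact there exists n₀ ∈ ℕ with Σ_{n=0}^∞ Tⁿ(p_R^⊥) ≤ 2n₀ · p_R^⊥. In particular Tⁿ(p_R) → 1. -/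
open Filter Topology ContinuousLinearMap

namespace QMP

variable {H : Type*} [NormedAddCommGroup H] [InnerProductSpace ℂ H] [CompleteSpace H]

/-- A normal state on the von Neumann algebra `A`: a positive unital linear functional which
is continuous along bounded monotone sequences converging in the strong operator topology. -/
structure IsNormalState (A : VonNeumannAlgebra H) (φ : (H →L[ℂ] H) → ℂ) : Prop where
  linear : IsLinearMap ℂ φ
  unital : φ 1 = 1
  pos : ∀ x : H →L[ℂ] H, 0 ≤ x → ∃ r : ℝ, 0 ≤ r ∧ φ x = r
  normal : ∀ (f : ℕ → (H →L[ℂ] H)) (y : H →L[ℂ] H), (∀ n, f n ∈ A) → Monotone f →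
    (∀ η : H, Filter.Tendsto (fun n => (f n) η) Filter.atTop (nhds (y η))) →
    Filter.Tendsto (fun n => φ (f n)) Filter.atTop (nhds (φ y))

/-- `φ` is stationary for `T`: `φ ∘ T = φ`. -/
def Stationary (T : (H →L[ℂ] H) → (H →L[ℂ] H)) (φ : (H →L[ℂ] H) → ℂ) : Prop :=
  ∀ x : H →L[ℂ] H, φ (T x) = φ x

/-- `s` is the support projection of the state `φ`: the smallest projection `p ∈ A` with
`φ x = φ (p x p)` for all `x ∈ A`. -/
def IsStateSupport (A : VonNeumannAlgebra H) (φ : (H →L[ℂ] H) → ℂ)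
    (s : H →L[ℂ] H) : Prop :=
  IsProj A s ∧ (∀ x ∈ A, φ x = φ (s * x * s)) ∧
    ∀ q, IsProj A q → (∀ x ∈ A, φ x = φ (q * x * q)) → s ≤ q

/-- `r` is the maximal positive recurrent projection `p_R`: the supremum of the supports of
all stationary normal states of `T`. -/
def IsMaxPosRecurrent (A : VonNeumannAlgebra H) (T : (H →L[ℂ] H) → (H →L[ℂ] H))
    (r : H →L[ℂ] H) : Prop :=
  IsProj A r ∧
    (∀ φ s, IsNormalState A φ → Stationary T φ → IsStateSupport A φ s → s ≤ r) ∧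
    ∀ q, IsProj A q →
      (∀ φ s, IsNormalState A φ → Stationary T φ → IsStateSupport A φ s → s ≤ q) → r ≤ q

end QMP

open QMP Filter Topology

namespace QMP

open scoped ComplexOrder

lemma eq_conj_of_mul_one_sub_eq_zero {B : Type*} [Ring B] [StarRing B] {x p : B}
    (hx : IsSelfAdjoint x) (hp : IsSelfAdjoint p)
    (h : x * (1 - p) = 0) : x = p * x * p := by
  have h1 : x * p = x := by rw [mul_sub, mul_one, sub_eq_zero] at h; exact h.symm
  have h2 : p * x = x := by simpa [hx.star_eq, hp.star_eq] using congrArg star h1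
  rw [h2, h1]

section CStar

variable {B : Type*} [CStarAlgebra B] [PartialOrder B] [StarOrderedRing B]

lemma mul_eq_zero_of_le_of_mul_eq_zero {a b x : B} (ha : 0 ≤ a) (hab : a ≤ b)
    (hx : b * x = 0) : a * x = 0 := by
  have h1 : star x * a * x ≤ 0 := by
    simpa [mul_assoc, hx] using star_left_conjugate_le_conjugate hab x
  have h2 : 0 ≤ star x * a * x := star_left_conjugate_nonneg ha x
  obtain ⟨y, rfl⟩ := CStarAlgebra.nonneg_iff_eq_star_mul_self.mp ha
  have h3 : star (y * x) * (y * x) = 0 := by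
    rw [← le_antisymm h1 h2]; simp only [star_mul, mul_assoc]
  rw [mul_assoc, CStarRing.star_mul_self_eq_zero_iff _ |>.mp h3, mul_zero]

lemma proj_nonneg {p : B} (hs : IsSelfAdjoint p) (hi : IsIdempotentElem p) : 0 ≤ p := by
  have := star_mul_self_nonneg p
  rwa [hs.star_eq, hi.eq] at this

lemma proj_le_one {p : B} (hs : IsSelfAdjoint p) (hi : IsIdempotentElem p) : p ≤ 1 :=
  sub_nonneg.mp (proj_nonneg ((IsSelfAdjoint.one B).sub hs) hi.one_sub)

lemma le_smul_proj {x p : B} {c : ℝ} (hx : IsSelfAdjoint x) (hp : IsSelfAdjoint p)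
    (hi : IsIdempotentElem p) (h : x * (1 - p) = 0) (hc : x ≤ c • (1 : B)) : x ≤ c • p := by
  have h1 := IsSelfAdjoint.conjugate_le_conjugate hc hp
  rwa [← eq_conj_of_mul_one_sub_eq_zero hx hp h, mul_smul_comm, smul_mul_assoc, mul_one,
    hi.eq] at h1

lemma complex_eq_zero_of_forall_real {K z : ℂ} (h : ∀ t : ℝ, 0 ≤ K + t * z) : z = 0 := by
  have him : ∀ t : ℝ, K.im + t * z.im = 0 := fun t => by
    simpa using ((Complex.nonneg_iff.mp (h t)).2).symm
  have hre : ∀ t : ℝ, 0 ≤ K.re + t * z.re := fun t => by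
    simpa using (Complex.nonneg_iff.mp (h t)).1
  apply Complex.ext
  · by_contra hz
    have hz' : z.re ≠ 0 := hz
    have := hre (-(K.re + 1) / z.re)
    rw [div_mul_cancel₀ _ hz'] at this
    linarith
  · have h0 := him 0
    have h1 := him 1
    simp only [Complex.zero_im]
    linarith

variable {φ : B →ₗ[ℂ] ℂ}

lemma apply_mul_proj_eq_zero (hpos : ∀ x, 0 ≤ x → 0 ≤ φ x) {p : B}
    (hs : IsSelfAdjoint p) (hi : IsIdempotentElem p) (h0 : φ p = 0) (x : B) :
    φ (x * p) = 0 ∧ φ (p * star x) = 0 := by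
  have key : ∀ c : ℂ, 0 ≤ φ (x * star x) + (c * φ (x * p) + star c * φ (p * star x)) := by
    intro c
    have h := hpos _ (star_mul_self_nonneg (star x + c • p))
    have e : star (star x + c • p) * (star x + c • p) =
        x * star x + (c • (x * p) + star c • (p * star x)) + (c * star c) • p := by
      simp only [star_add, star_star, star_smul, hs.star_eq, add_mul, mul_add, smul_mul_assoc,
        mul_smul_comm, hi.eq, smul_add, smul_smul]
      abel
    rw [e] at h
    simpa [h0] using h
  have h1 : φ (x * p) + φ (p * star x) = 0 :=
    complex_eq_zero_of_forall_real (K := φ (x * star x)) fun t => by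
      have := key t
      simpa [mul_add] using this
  have h2 : Complex.I * (φ (x * p) - φ (p * star x)) = 0 :=
    complex_eq_zero_of_forall_real (K := φ (x * star x)) fun t => by
      have := key (t * Complex.I)
      have e : (t : ℂ) * (Complex.I * (φ (x * p) - φ (p * star x))) =
        t * Complex.I * φ (x * p) + star (t * Complex.I) * φ (p * star x) := by
        simp; ring
      rwa [e]
  have h3 : φ (x * p) - φ (p * star x) = 0 := by simpa using h2
  have h4 : φ (x * p) = 0 := by linear_combination (h1 + h3) / 2
  exact ⟨h4, by linear_combination h1 - h4⟩

lemma apply_eq_apply_conj (hpos : ∀ x, 0 ≤ x → 0 ≤ φ x) {q : B}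
    (hs : IsSelfAdjoint q) (hi : IsIdempotentElem q) (h0 : φ (1 - q) = 0) (x : B) :
    φ x = φ (q * x * q) := by
  have hs' : IsSelfAdjoint (1 - q) := (IsSelfAdjoint.one B).sub hs
  have h1 := (apply_mul_proj_eq_zero hpos hs' hi.one_sub h0 (q * x)).1
  have h2 := (apply_mul_proj_eq_zero hpos hs' hi.one_sub h0 (star x)).2
  rw [star_star] at h2
  have e : x = q * x * q + q * x * (1 - q) + (1 - q) * x := by noncomm_ring
  conv_lhs => rw [e, map_add, map_add, h1, h2, add_zero, add_zero]

lemma apply_eq_zero_of_le (hpos : ∀ x, 0 ≤ x → 0 ≤ φ x) {a b : B} (ha : 0 ≤ a)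
    (hab : a ≤ b) (hb : φ b = 0) : φ a = 0 := by
  have h := hpos _ (sub_nonneg.mpr hab)
  rw [map_sub, hb, zero_sub] at h
  exact le_antisymm (neg_nonneg.mp h) (hpos _ ha)

lemma exists_bound_apply (x : B) : ∃ M : ℝ, ∀ φ : B →ₗ[ℂ] ℂ,
    (∀ x, 0 ≤ x → 0 ≤ φ x) → φ 1 = 1 → ‖φ x‖ ≤ M := by
  have hx : x ∈ Submodule.span ℂ {a : B | 0 ≤ a} := by
    rw [CStarAlgebra.span_nonneg]; trivial
  induction hx using Submodule.span_induction with
  | mem a ha =>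
    refine ⟨‖a‖, fun φ hpos h1 => ?_⟩
    have h2 : a ≤ ((‖a‖ : ℝ) : ℂ) • (1 : B) := by
      have := IsSelfAdjoint.le_algebraMap_norm_self (IsSelfAdjoint.of_nonneg ha)
      rwa [Algebra.algebraMap_eq_smul_one, ← Complex.coe_smul] at this
    have h3 := hpos _ (sub_nonneg.mpr h2)
    rw [map_sub, map_smul, h1, smul_eq_mul, mul_one, sub_nonneg] at h3
    have h4 := hpos a ha
    have := Complex.norm_of_nonneg' h4
    rw [← this] at h3
    exact_mod_cast h3
  | zero => exact ⟨0, fun φ _ _ => by simp⟩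
  | add a b _ _ iha ihb =>
    obtain ⟨M, hM⟩ := iha
    obtain ⟨N, hN⟩ := ihb
    refine ⟨M + N, fun φ hpos h1 => ?_⟩
    rw [map_add]
    exact (norm_add_le _ _).trans (add_le_add (hM φ hpos h1) (hN φ hpos h1))
  | smul c a _ iha =>
    obtain ⟨M, hM⟩ := iha
    refine ⟨‖c‖ * M, fun φ hpos h1 => ?_⟩
    rw [map_smul, norm_smul]
    exact mul_le_mul_of_nonneg_left (hM φ hpos h1) (norm_nonneg _)

/-- Pointwise ultrafilter limits of states. -/
lemma exists_limit_state (u : Ultrafilter ℕ) (ψ : ℕ → B →ₗ[ℂ] ℂ)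
    (hpos : ∀ n x, 0 ≤ x → 0 ≤ ψ n x) (h1 : ∀ n, ψ n 1 = 1) :
    ∃ φ : B →ₗ[ℂ] ℂ, (∀ x, 0 ≤ x → 0 ≤ φ x) ∧ φ 1 = 1 ∧
      ∀ x, Tendsto (fun n => ψ n x) u (𝓝 (φ x)) := by
  have hlim : ∀ x, ∃ z, Tendsto (fun n => ψ n x) u (𝓝 z) := by
    intro x
    obtain ⟨M, hM⟩ := exists_bound_apply x
    obtain ⟨z, -, hz⟩ := (isCompact_closedBall (0 : ℂ) M).ultrafilter_le_nhds
      (u.map fun n => ψ n x) (by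
        rw [Filter.le_principal_iff, Ultrafilter.coe_map]
        exact Filter.mem_map.mpr (Filter.univ_mem' fun n => by
          simpa using hM (ψ n) (hpos n) (h1 n)))
    exact ⟨z, hz⟩
  choose f hf using hlim
  refine ⟨{ toFun := f, map_add' := fun x y => ?_, map_smul' := fun c x => ?_ },
    fun x hx => ?_, ?_, hf⟩
  · exact tendsto_nhds_unique (hf (x + y)) (by simpa using (hf x).add (hf y))
  · exact tendsto_nhds_unique (hf (c • x)) (by simpa using (hf x).const_mul c)
  · exact ge_of_tendsto (hf x) (Filter.Eventually.of_forall fun n => hpos n x hx)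
  · exact tendsto_nhds_unique (hf 1) (by simp [h1])

/-- If, along a sequence of states `ω n`, the values at `Tⁿ⁺¹ p` of a decreasing orbit stay above
`1 / 2`, then some stationary state does not vanish at `p`. -/
lemma exists_stationary_apply_ne_zero (T : B →ₗ[ℂ] B) (hT : ∀ x, 0 ≤ x → 0 ≤ T x)
    (hT1 : T 1 = 1) {p : B} (hanti : Antitone fun n => (T ^ n) p) (ω : ℕ → B →ₗ[ℂ] ℂ)
    (hpos : ∀ n x, 0 ≤ x → 0 ≤ ω n x) (h1 : ∀ n, ω n 1 = 1)
    (hω : ∀ n, 1 / 2 ≤ ω n ((T ^ (n + 1)) p)) :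
    ∃ φ : B →ₗ[ℂ] ℂ, (∀ x, 0 ≤ x → 0 ≤ φ x) ∧ φ 1 = 1 ∧ (∀ x, φ (T x) = φ x) ∧ φ p ≠ 0 := by
  have hTn : ∀ n x, 0 ≤ x → 0 ≤ (T ^ n) x := by
    intro n
    induction n with
    | zero => intro x hx; simpa using hx
    | succ n ih => intro x hx; rw [pow_succ]; exact ih _ (hT x hx)
  have hTn1 : ∀ n, (T ^ n) 1 = 1 := by
    intro n
    induction n with
    | zero => simp
    | succ n ih => rw [pow_succ, Module.End.mul_apply, hT1, ih]
  let ψ : ℕ → B →ₗ[ℂ] ℂ := fun n =>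
    ((n : ℂ) + 1)⁻¹ • ∑ k ∈ Finset.range (n + 1), (ω n).comp (T ^ k)
  have hψ : ∀ n x, ψ n x = ((n : ℂ) + 1)⁻¹ * ∑ k ∈ Finset.range (n + 1), ω n ((T ^ k) x) := by
    intro n x
    simp [ψ, LinearMap.sum_apply]
  have hn0 : ∀ n : ℕ, (n : ℂ) + 1 ≠ 0 := fun n => by exact_mod_cast n.succ_ne_zero
  have hninv : ∀ n : ℕ, 0 ≤ ((n : ℂ) + 1)⁻¹ := fun n => by
    have : (0 : ℝ) ≤ ((n : ℝ) + 1)⁻¹ := by positivity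
    have h := Complex.zero_le_real.mpr this
    push_cast at h
    exact h
  obtain ⟨φ, hφpos, hφ1, hφ⟩ := exists_limit_state (Filter.hyperfilter ℕ) ψ
    (fun n x hx => by
      rw [hψ]
      exact mul_nonneg (hninv n) (Finset.sum_nonneg fun k _ => hpos n _ (hTn k x hx)))
    (fun n => by
      rw [hψ]
      simp [hTn1, h1, inv_mul_cancel₀ (hn0 n)])
  refine ⟨φ, hφpos, hφ1, fun x => ?_, fun h0 => ?_⟩
  · obtain ⟨M, hM⟩ := exists_bound_apply x
    have hd : Tendsto (fun n => ψ n (T x) - ψ n x) atTop (𝓝 0) := by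
      have hb : ∀ n : ℕ, ‖ψ n (T x) - ψ n x‖ ≤ (M + M) * (1 / ((n : ℝ) + 1)) := by
        intro n
        have e : ψ n (T x) - ψ n x =
            ((n : ℂ) + 1)⁻¹ * (ω n ((T ^ (n + 1)) x) - ω n x) := by
          rw [hψ, hψ, ← mul_sub, ← Finset.sum_sub_distrib]
          congr 1
          have := Finset.sum_range_sub (fun k => ω n ((T ^ k) x)) (n + 1)
          simpa [pow_succ] using this
        rw [e, norm_mul, mul_comm]
        have h2 : ‖((n : ℂ) + 1)⁻¹‖ = 1 / ((n : ℝ) + 1) := by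
          rw [norm_inv, one_div]
          congr 1
          exact_mod_cast Complex.norm_natCast (n + 1)
        rw [h2]
        refine mul_le_mul_of_nonneg_right ?_ (by positivity)
        refine (norm_sub_le _ _).trans (add_le_add ?_ (hM _ (hpos n) (h1 n)))
        exact hM ((ω n).comp (T ^ (n + 1))) (fun y hy => hpos n _ (hTn _ y hy))
          (by simp [hTn1, h1])
      refine squeeze_zero_norm hb ?_
      simpa using (tendsto_one_div_add_atTop_nhds_zero_nat (𝕜 := ℝ)).const_mul (M + M)
    have := tendsto_nhds_unique ((hφ (T x)).sub (hφ x)) (hd.mono_left Nat.hyperfilter_le_atTop)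
    exact sub_eq_zero.mp this
  · have hge : (1 / 2 : ℂ) ≤ φ p := by
      refine ge_of_tendsto (hφ p) (Filter.Eventually.of_forall fun n => ?_)
      have h2 : ∑ _k ∈ Finset.range (n + 1), (1 / 2 : ℂ) ≤
          ∑ k ∈ Finset.range (n + 1), ω n ((T ^ k) p) := by
        refine Finset.sum_le_sum fun k hk => (hω n).trans ?_
        have h3 : (T ^ (n + 1)) p ≤ (T ^ k) p := hanti (Finset.mem_range.mp hk).le
        have h4 := hpos n _ (sub_nonneg.mpr h3)
        rwa [map_sub, sub_nonneg] at h4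
      have h5 := mul_le_mul_of_nonneg_left h2 (hninv n)
      rw [Finset.sum_const, Finset.card_range, nsmul_eq_mul] at h5
      push_cast at h5
      rw [← mul_assoc, inv_mul_cancel₀ (hn0 n), one_mul] at h5
      rw [hψ]
      exact h5
    rw [h0] at hge
    have := (Complex.le_def.mp hge).1
    norm_num at this

end CStar

/-- Geometric series estimate for sequences that halve after `n₀` steps. -/
lemma sum_range_le_of_half {E : Type*} [AddCommGroup E] [PartialOrder E] [IsOrderedAddMonoid E]
    [Module ℝ E] [PosSMulMono ℝ E] {a : ℕ → E} {p : E} {n₀ : ℕ} (hn₀ : 0 < n₀) (hp : 0 ≤ p)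
    (hap : ∀ n, a n ≤ p) (hhalf : ∀ n, a (n₀ + n) ≤ (1 / 2 : ℝ) • a n) (N : ℕ) :
    ∑ n ∈ Finset.range N, a n ≤ (2 * n₀ : ℕ) • p := by
  have hle : ∀ k, ∑ n ∈ Finset.range k, a n ≤ k • p := fun k => by
    simpa using Finset.sum_le_card_nsmul (Finset.range k) a p fun n _ => hap n
  induction N using Nat.strong_induction_on with
  | _ N ih =>
    rcases le_or_gt N n₀ with h | h
    · exact (hle N).trans (nsmul_le_nsmul_left hp (by omega))
    · obtain ⟨M, rfl⟩ := Nat.exists_eq_add_of_le h.le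
      rw [Finset.sum_range_add]
      have h1 : ∑ j ∈ Finset.range M, a (n₀ + j) ≤ n₀ • p := by
        calc ∑ j ∈ Finset.range M, a (n₀ + j)
            ≤ ∑ j ∈ Finset.range M, (1 / 2 : ℝ) • a j := Finset.sum_le_sum fun j _ => hhalf j
          _ = (1 / 2 : ℝ) • ∑ j ∈ Finset.range M, a j := Finset.smul_sum.symm
          _ ≤ (1 / 2 : ℝ) • (2 * n₀ : ℕ) • p :=
              smul_le_smul_of_nonneg_left (ih M (by omega)) (by norm_num)
          _ = n₀ • p := by
              rw [← Nat.cast_smul_eq_nsmul ℝ, ← Nat.cast_smul_eq_nsmul ℝ, smul_smul]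
              congr 1
              push_cast
              ring
      rw [two_mul, add_nsmul]
      exact add_le_add (hle n₀) h1

section Hilbert

variable {H : Type*} [NormedAddCommGroup H] [InnerProductSpace ℂ H]

/-- The vector functional of `v`. -/
noncomputable def vectorFunctional (v : H) : (H →L[ℂ] H) →ₗ[ℂ] ℂ where
  toFun x := inner ℂ v (x v)
  map_add' x y := by simp
  map_smul' c x := by simp

lemma vectorFunctional_nonneg (v : H) {x : H →L[ℂ] H} (hx : 0 ≤ x) :
    0 ≤ vectorFunctional v x :=
  ((ContinuousLinearMap.nonneg_iff_isPositive x).mp hx).inner_nonneg_right v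

section FiniteDimensional

variable [FiniteDimensional ℂ H]

lemma finite_spectrum_real (a : H →L[ℂ] H) : (spectrum ℝ a).Finite := by
  have h : (spectrum ℂ a).Finite := by
    rw [← AlgEquiv.spectrum_eq (Module.End.toContinuousLinearMap (𝕜 := ℂ) H).symm a]
    exact Module.End.finite_spectrum _
  rw [← spectrum.preimage_algebraMap ℂ]
  exact h.preimage (FaithfulSMul.algebraMap_injective ℝ ℂ).injOn

lemma tendsto_of_tendsto_apply {α : Type*} {l : Filter α} {f : α → H →L[ℂ] H} {y : H →L[ℂ] H}
    (h : ∀ η, Tendsto (fun n => f n η) l (𝓝 (y η))) : Tendsto f l (𝓝 y) := by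
  let b := Module.finBasis ℂ H
  let E : (H →L[ℂ] H) →ₗ[ℂ] (Fin (Module.finrank ℂ H) → H) :=
    { toFun := fun x i => x (b i), map_add' := fun _ _ => rfl, map_smul' := fun _ _ => rfl }
  have hE : LinearMap.ker E = ⊥ := by
    refine LinearMap.ker_eq_bot'.mpr fun x hx => ?_
    have : (x : H →ₗ[ℂ] H) = 0 := b.ext fun i => congrFun hx i
    exact ContinuousLinearMap.coe_injective this
  rw [(LinearMap.isClosedEmbedding_of_injective hE).tendsto_nhds_iff]
  exact tendsto_pi_nhds.mpr fun i => h (b i)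

end FiniteDimensional

variable [CompleteSpace H]

lemma cfc_mem {A : VonNeumannAlgebra H} {a : H →L[ℂ] H} (ha : a ∈ A) (hsa : IsSelfAdjoint a)
    (f : ℝ → ℝ) : cfc f a ∈ A := by
  rw [← VonNeumannAlgebra.commutant_commutant A, VonNeumannAlgebra.mem_commutant_iff]
  intro g hg
  have hga : Commute a g := VonNeumannAlgebra.mem_commutant_iff.mp hg a ha
  exact (hsa.commute_cfc hga f).eq.symm

lemma isClosed_vonNeumannAlgebra (A : VonNeumannAlgebra H) :
    IsClosed (A : Set (H →L[ℂ] H)) := by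
  rw [← VonNeumannAlgebra.centralizer_centralizer A]
  exact Set.isClosed_centralizer _

lemma IsProj.one_sub {A : VonNeumannAlgebra H} {p : H →L[ℂ] H} (hp : IsProj A p) :
    IsProj A (1 - p) :=
  ⟨sub_mem (one_mem A) hp.1, (IsSelfAdjoint.one _).sub hp.2.1, hp.2.2.one_sub⟩

lemma proj_le_of_mul_one_sub {A : VonNeumannAlgebra H} {p q : H →L[ℂ] H} (hp : IsProj A p)
    (hq : IsProj A q) (h : p * (1 - q) = 0) : p ≤ q := by
  simpa using le_smul_proj (c := 1) hp.2.1 hq.2.1 hq.2.2 h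
    (by simpa using proj_le_one hp.2.1 hp.2.2)

lemma apply_range_proj_eq_zero {φ : (H →L[ℂ] H) →ₗ[ℂ] ℂ} (hpos : ∀ x, 0 ≤ x → 0 ≤ φ x)
    {a p : H →L[ℂ] H} (hp : 0 ≤ p) {c : ℝ} (hpc : p ≤ c • a) (ha : φ a = 0) : φ p = 0 := by
  refine apply_eq_zero_of_le hpos hp hpc ?_
  rw [← Complex.coe_smul, map_smul, ha, smul_zero]

lemma exists_unit_vector_of_not_le {x : H →L[ℂ] H} {c : ℝ} (hx : IsSelfAdjoint x)
    (h : ¬ x ≤ c • (1 : H →L[ℂ] H)) :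
    ∃ v : H, ‖v‖ = 1 ∧ (c : ℂ) ≤ vectorFunctional v x := by
  have hsa : IsSelfAdjoint (c • (1 : H →L[ℂ] H) - x) :=
    (IsSelfAdjoint.smul (IsSelfAdjoint.all c) (IsSelfAdjoint.one _)).sub hx
  rw [ContinuousLinearMap.le_def, ContinuousLinearMap.isPositive_def'] at h
  have h' : ∃ v, (c • (1 : H →L[ℂ] H) - x).reApplyInnerSelf v < 0 := by
    by_contra! hcon
    exact h ⟨hsa, hcon⟩
  obtain ⟨v, hv⟩ := h'
  have hv0 : v ≠ 0 := by
    rintro rfl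
    simp [ContinuousLinearMap.reApplyInnerSelf_apply] at hv
  have hn : ‖v‖ ≠ 0 := norm_ne_zero_iff.mpr hv0
  have hsym : inner ℂ (x v) v = inner ℂ v (x v) :=
    (ContinuousLinearMap.isSelfAdjoint_iff_isSymmetric.mp hx) v v
  have him : (inner ℂ v (x v) : ℂ).im = 0 := by
    have h1 := inner_conj_symm (𝕜 := ℂ) v (x v)
    rw [hsym] at h1
    exact Complex.conj_eq_iff_im.mp h1
  have hre : c * ‖v‖ ^ 2 < (inner ℂ v (x v) : ℂ).re := by
    rw [ContinuousLinearMap.reApplyInnerSelf_apply] at hv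
    have e : inner ℂ ((c • (1 : H →L[ℂ] H) - x) v) v
        = ((c * ‖v‖ ^ 2 : ℝ) : ℂ) - inner ℂ v (x v) := by
      rw [← Complex.coe_smul, sub_apply, inner_sub_left, hsym]
      simp [inner_self_eq_norm_sq_to_K]
    rw [e] at hv
    have hv' : c * ‖v‖ ^ 2 - (inner ℂ v (x v) : ℂ).re < 0 := by
      simpa only [RCLike.re_to_complex, Complex.sub_re, Complex.ofReal_re] using hv
    linarith
  refine ⟨((‖v‖⁻¹ : ℝ) : ℂ) • v, by simp [norm_smul, hn], ?_⟩
  have e : vectorFunctional (((‖v‖⁻¹ : ℝ) : ℂ) • v) x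
      = ((‖v‖⁻¹ ^ 2 : ℝ) : ℂ) * inner ℂ v (x v) := by
    change inner ℂ _ (x _) = _
    rw [map_smul, inner_smul_left, inner_smul_right, Complex.conj_ofReal]
    push_cast
    ring
  rw [e, Complex.le_def, Complex.re_ofReal_mul, Complex.im_ofReal_mul, him]
  refine ⟨?_, by simp⟩
  rw [Complex.ofReal_re, inv_pow, inv_mul_eq_div, le_div_iff₀ (by positivity)]
  exact hre.le

variable [FiniteDimensional ℂ H]

/-- The range projection of a positive element of a finite dimensional von Neumann algebra. -/
lemma exists_range_proj {A : VonNeumannAlgebra H} {a : H →L[ℂ] H} (ha : a ∈ A) (h0 : 0 ≤ a) :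
    ∃ p, IsProj A p ∧ a * (1 - p) = 0 ∧ ∃ c : ℝ, p ≤ c • a := by
  have hsa : IsSelfAdjoint a := IsSelfAdjoint.of_nonneg h0
  have hc : ∀ f : ℝ → ℝ, ContinuousOn f (spectrum ℝ a) := fun f =>
    (finite_spectrum_real a).continuousOn f
  let f : ℝ → ℝ := fun x => if x = 0 then 0 else 1
  refine ⟨cfc f a, ⟨cfc_mem ha hsa f, cfc_predicate f a, ?_⟩, ?_, ?_⟩
  · rw [IsIdempotentElem, ← cfc_mul f f a (hc _) (hc _)]
    congr 1
    funext x
    by_cases hx : x = 0 <;> simp [f, hx]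
  · have : a * cfc f a = a := by
      have h := cfc_mul (fun x => x) f a (hc _) (hc _)
      rw [cfc_id' ℝ a] at h
      rw [← h]
      conv_rhs => rw [← cfc_id' ℝ a]
      congr 1
      funext x
      by_cases hx : x = 0 <;> simp [f, hx]
    rw [mul_sub, mul_one, this, sub_self]
  · obtain ⟨c, hcb⟩ := ((finite_spectrum_real a).image fun x => x⁻¹).bddAbove
    refine ⟨c, ?_⟩
    rw [← cfc_const_mul_id c a]
    refine cfc_mono (fun x hx => ?_) (hc _) (hc _)
    have hx0 : 0 ≤ x := spectrum_nonneg_of_nonneg h0 hx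
    by_cases hx' : x = 0
    · simp [f, hx']
    · have h1 : x⁻¹ ≤ c := hcb ⟨x, hx, rfl⟩
      have h2 := mul_le_mul_of_nonneg_right h1 hx0
      rw [inv_mul_cancel₀ hx'] at h2
      simpa [f, hx'] using h2

/-- Every state on a finite dimensional von Neumann algebra has a support projection. -/
lemma exists_isStateSupport (A : VonNeumannAlgebra H) {φ : (H →L[ℂ] H) →ₗ[ℂ] ℂ}
    (hpos : ∀ x, 0 ≤ x → 0 ≤ φ x) : ∃ s, IsStateSupport A φ s := by
  let S : Set (Submodule ℂ H) :=
    {V | ∃ p : H →L[ℂ] H, IsProj A p ∧ φ p = 0 ∧ LinearMap.range (p : H →ₗ[ℂ] H) = V}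
  have hS : S.Nonempty :=
    ⟨_, 0, ⟨zero_mem A, IsSelfAdjoint.zero _, IsIdempotentElem.zero⟩, map_zero φ, rfl⟩
  obtain ⟨_, ⟨p, hp, hp0, rfl⟩, hmax⟩ :=
    (wellFounded_gt (α := Submodule ℂ H)).has_min S hS
  have hpn := proj_nonneg hp.2.1 hp.2.2
  refine ⟨1 - p, hp.one_sub, fun x _ => apply_eq_apply_conj hpos hp.one_sub.2.1
    hp.one_sub.2.2 (by simpa using hp0) x, fun q hq hφq => ?_⟩
  have he := hq.one_sub
  have hen := proj_nonneg he.2.1 he.2.2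
  have hφe : φ (1 - q) = 0 := by
    have := hφq 1 (one_mem A)
    rw [mul_one, hq.2.2.eq] at this
    rw [map_sub, this, sub_self]
  obtain ⟨p', hp', hbp', c, hc⟩ :=
    exists_range_proj (add_mem hp.1 he.1) (add_nonneg hpn hen)
  have hp'0 : φ p' = 0 := apply_range_proj_eq_zero hpos (proj_nonneg hp'.2.1 hp'.2.2) hc
    (by rw [map_add, hp0, hφe, add_zero])
  have h1 : p * (1 - p') = 0 :=
    mul_eq_zero_of_le_of_mul_eq_zero hpn (le_add_of_nonneg_right hen) hbp'
  have h2 : (1 - q) * (1 - p') = 0 :=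
    mul_eq_zero_of_le_of_mul_eq_zero hen (le_add_of_nonneg_left hpn) hbp'
  have h3 : p' * p = p := by
    have h4 : p * p' = p := by rw [mul_sub, mul_one, sub_eq_zero] at h1; exact h1.symm
    simpa [hp.2.1.star_eq, hp'.2.1.star_eq] using congrArg star h4
  have hle : LinearMap.range (p : H →ₗ[ℂ] H) ≤ LinearMap.range (p' : H →ₗ[ℂ] H) := by
    rintro _ ⟨v, rfl⟩
    exact ⟨p v, DFunLike.congr_fun h3 v⟩
  have heq : LinearMap.range (p : H →ₗ[ℂ] H) = LinearMap.range (p' : H →ₗ[ℂ] H) := by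
    by_contra hne
    exact hmax _ ⟨p', hp', hp'0, rfl⟩ (lt_of_le_of_ne hle hne)
  have h5 : p * p' = p' := by
    ext v
    have hv : p' v ∈ LinearMap.range (p : H →ₗ[ℂ] H) := heq ▸ ⟨v, rfl⟩
    obtain ⟨w, hw⟩ := hv
    have hw' : p w = p' v := hw
    change p (p' v) = p' v
    rw [← hw']
    exact DFunLike.congr_fun hp.2.2.eq w
  have h6 : p = p' := by
    rw [← h5]; rw [mul_sub, mul_one, sub_eq_zero] at h1; exact h1
  rw [← h6] at h2
  have := proj_le_of_mul_one_sub he hp h2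
  exact sub_le_comm.mp this

lemma isNormalState_of_pos (A : VonNeumannAlgebra H) {φ : (H →L[ℂ] H) →ₗ[ℂ] ℂ}
    (hpos : ∀ x, 0 ≤ x → 0 ≤ φ x) (h1 : φ 1 = 1) : IsNormalState A φ where
  linear := φ.isLinear
  unital := h1
  pos x hx := by
    obtain ⟨hre, him⟩ := Complex.nonneg_iff.mp (hpos x hx)
    exact ⟨(φ x).re, hre, Complex.ext (by simp) (by simp [← him])⟩
  normal f y _ _ h :=
    (φ.continuous_of_finiteDimensional.tendsto y).comp (tendsto_of_tendsto_apply h)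

/-- A stationary state vanishes on the complement of the maximal positive recurrent
projection. -/
lemma apply_one_sub_maxPosRecurrent {A : VonNeumannAlgebra H} {T : (H →L[ℂ] H) → (H →L[ℂ] H)}
    {r : H →L[ℂ] H} (hr : IsMaxPosRecurrent A T r) {φ : (H →L[ℂ] H) →ₗ[ℂ] ℂ}
    (hpos : ∀ x, 0 ≤ x → 0 ≤ φ x) (h1 : φ 1 = 1) (hφ : Stationary T φ) : φ (1 - r) = 0 := by
  obtain ⟨s, hs⟩ := exists_isStateSupport A hpos
  have hsr : s ≤ r := hr.2.1 φ s (isNormalState_of_pos A hpos h1) hφ hs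
  have hφs : φ (1 - s) = 0 := by
    have := hs.2.1 1 (one_mem A)
    rw [mul_one, hs.1.2.2.eq] at this
    rw [map_sub, this, sub_self]
  have hr' := hr.1.one_sub
  exact apply_eq_zero_of_le hpos (proj_nonneg hr'.2.1 hr'.2.2) (sub_le_sub_left hsr 1) hφs

/-- A positive element on which all stationary states vanish is orthogonal to the maximal
positive recurrent projection. -/
lemma mul_maxPosRecurrent_eq_zero {A : VonNeumannAlgebra H} {T : (H →L[ℂ] H) → (H →L[ℂ] H)}
    {r : H →L[ℂ] H} (hr : IsMaxPosRecurrent A T r) {b : H →L[ℂ] H} (hb : b ∈ A) (hb0 : 0 ≤ b)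
    (hφb : ∀ φ : (H →L[ℂ] H) →ₗ[ℂ] ℂ, (∀ x, 0 ≤ x → 0 ≤ φ x) → φ 1 = 1 →
      Stationary T φ → φ b = 0) :
    b * r = 0 := by
  obtain ⟨p, hp, hbp, c, hc⟩ := exists_range_proj hb hb0
  have hpn := proj_nonneg hp.2.1 hp.2.2
  have hrp : r ≤ 1 - p := by
    refine hr.2.2 _ hp.one_sub fun φ s hφ hst hs => ?_
    let φ' : (H →L[ℂ] H) →ₗ[ℂ] ℂ := hφ.linear.mk' φ
    have hpos : ∀ x, 0 ≤ x → 0 ≤ φ' x := fun x hx => by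
      obtain ⟨t, ht, htx⟩ := hφ.pos x hx
      change 0 ≤ φ x
      rw [htx]
      exact Complex.zero_le_real.mpr ht
    refine hs.2.2 _ hp.one_sub fun x _ =>
      apply_eq_apply_conj hpos hp.one_sub.2.1 hp.one_sub.2.2 ?_ x
    rw [sub_sub_cancel]
    exact apply_range_proj_eq_zero hpos hpn hc (hφb φ' hpos hφ.unital hst)
  have hpr : p ≤ 1 - r := le_sub_comm.mp hrp
  have h1 : p * r = 0 := mul_eq_zero_of_le_of_mul_eq_zero hpn hpr
    (by rw [sub_mul, one_mul, hr.1.2.2.eq, sub_self])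
  have h2 : b = b * p := by rwa [mul_sub, mul_one, sub_eq_zero] at hbp
  rw [h2, mul_assoc, h1, mul_zero]

end Hilbert

end QMP

/-- In the finite dimensional case, `p_R^⊥` is `T`-summable; in fact there is `n₀` with
`∑ₙ Tⁿ(p_R^⊥) ≤ 2n₀ · p_R^⊥`. In particular `Tⁿ(p_R) → 1` (strongly). -/
theorem finite_dim_pR_complement_summable
    {H : Type*} [NormedAddCommGroup H] [InnerProductSpace ℂ H] [CompleteSpace H]
    [FiniteDimensional ℂ H]
    (A : VonNeumannAlgebra H) (T : (H →L[ℂ] H) → (H →L[ℂ] H)) (hT : IsMarkov A T)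
    (r : H →L[ℂ] H) (hr : IsMaxPosRecurrent A T r) :
    (∃ n₀ : ℕ, 0 < n₀ ∧
      ∀ N : ℕ, (∑ n ∈ Finset.range N, T^[n] (1 - r)) ≤ (2 * n₀ : ℕ) • (1 - r)) ∧
    TSummable A T (1 - r) ∧
    (∀ η : H, Tendsto (fun n => (T^[n] r) η) atTop (𝓝 η)) := by
  let T' : (H →L[ℂ] H) →ₗ[ℂ] (H →L[ℂ] H) := hT.linear.mk' T
  have hiter : ∀ n x, T^[n] x = (T' ^ n) x := fun n x => by
    rw [Module.End.pow_apply]; rfl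
  have hTpos : ∀ x, 0 ≤ x → 0 ≤ T' x := fun x hx => by
    obtain ⟨y, rfl⟩ := CStarAlgebra.nonneg_iff_eq_star_mul_self.mp hx
    have h : 0 ≤ T (star y * y) := by simpa using hT.cp 1 (fun _ => y) (fun _ => 1)
    exact h
  have hTmono : ∀ x y, x ≤ y → T' x ≤ T' y := fun x y hxy => by
    have := hTpos _ (sub_nonneg.mpr hxy)
    rwa [map_sub, sub_nonneg] at this
  have hTnmono : ∀ n x y, x ≤ y → (T' ^ n) x ≤ (T' ^ n) y := by
    intro n
    induction n with
    | zero => intro x y h; simpa using h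
    | succ n ih => intro x y h; rw [pow_succ]; exact ih _ _ (hTmono x y h)
  set p : H →L[ℂ] H := 1 - r with hpdef
  have hp : IsProj A p := hr.1.one_sub
  have hp0 : 0 ≤ p := proj_nonneg hp.2.1 hp.2.2
  have hp1 : p ≤ 1 := proj_le_one hp.2.1 hp.2.2
  have hTp0 : 0 ≤ T' p := hTpos p hp0
  have hTp1 : T' p ≤ 1 := (hTmono p 1 hp1).trans_eq hT.unital
  have hTpr : T' p * (1 - p) = 0 := by
    have := mul_maxPosRecurrent_eq_zero hr (hT.mapsSelf p hp.1) hTp0 fun φ hpos h1 hφ =>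
      (hφ p).trans (apply_one_sub_maxPosRecurrent hr hpos h1 hφ)
    rwa [hpdef, sub_sub_cancel]
  have hTp : T' p ≤ p := by
    simpa using le_smul_proj (c := 1) (IsSelfAdjoint.of_nonneg hTp0) hp.2.1 hp.2.2 hTpr
      (by simpa using hTp1)
  have hanti : Antitone fun n => (T' ^ n) p := antitone_nat_of_succ_le fun n => by
    rw [pow_succ]
    exact hTnmono n _ _ hTp
  have hnonneg : ∀ n, 0 ≤ (T' ^ n) p := fun n => by simpa using hTnmono n 0 p hp0
  have hlep : ∀ n, (T' ^ n) p ≤ p := fun n => by simpa using hanti n.zero_le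
  obtain ⟨n₀, hn₀, hhalf⟩ : ∃ n₀ : ℕ, 0 < n₀ ∧ (T' ^ n₀) p ≤ (1 / 2 : ℝ) • (1 : H →L[ℂ] H) := by
    by_contra! hcon
    choose v hv hvp using fun n : ℕ => exists_unit_vector_of_not_le
      (IsSelfAdjoint.of_nonneg (hnonneg (n + 1))) (hcon (n + 1) n.succ_pos)
    obtain ⟨φ, hpos, h1, hst, hne⟩ := exists_stationary_apply_ne_zero T' hTpos hT.unital hanti
      (fun n => vectorFunctional (v n)) (fun n x hx => vectorFunctional_nonneg _ hx)
      (fun n => by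
        change inner ℂ (v n) (v n) = 1
        simp [inner_self_eq_norm_sq_to_K, hv])
      (fun n => by simpa using hvp n)
    exact hne (apply_one_sub_maxPosRecurrent hr hpos h1 hst)
  have hhalfp : (T' ^ n₀) p ≤ (1 / 2 : ℝ) • p := by
    refine le_smul_proj (IsSelfAdjoint.of_nonneg (hnonneg n₀)) hp.2.1 hp.2.2 ?_ hhalf
    exact mul_eq_zero_of_le_of_mul_eq_zero (hnonneg n₀) (hlep n₀)
      (by rw [mul_sub, mul_one, hp.2.2.eq, sub_self])
  have hstep : ∀ n, (T' ^ (n₀ + n)) p ≤ (1 / 2 : ℝ) • (T' ^ n) p := fun n => by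
    have := hTnmono n _ _ hhalfp
    rwa [← Module.End.mul_apply, ← pow_add, add_comm, ← Complex.coe_smul, map_smul,
      Complex.coe_smul] at this
  have hnorm : ∀ n, ‖(T' ^ (n₀ + n)) p‖ ≤ (1 / 2 : ℝ) • ‖(T' ^ n) p‖ := fun n => by
    have := CStarAlgebra.norm_le_norm_of_nonneg_of_le (hnonneg _) (hstep n)
    rwa [norm_smul, Real.norm_of_nonneg (by norm_num)] at this
  have hsummable : Summable fun n => (T' ^ n) p :=
    (summable_of_sum_range_le (fun _ => norm_nonneg _) (sum_range_le_of_half hn₀ (norm_nonneg p)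
      (fun n => CStarAlgebra.norm_le_norm_of_nonneg_of_le (hnonneg n) (hlep n)) hnorm)).of_norm
  have hmem : ∀ n, (T' ^ n) p ∈ A := fun n => by
    induction n with
    | zero => simpa using hp.1
    | succ n ih => rw [pow_succ']; exact hT.mapsSelf _ ih
  have hsum := hsummable.hasSum.tendsto_sum_nat
  refine ⟨⟨n₀, hn₀, fun N => ?_⟩, ⟨hp.1, hp0, ∑' n, (T' ^ n) p, ?_, tsum_nonneg hnonneg, ?_⟩, ?_⟩
  · simp only [hiter]
    exact sum_range_le_of_half hn₀ hp0 hlep hstep N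
  · exact (isClosed_vonNeumannAlgebra A).mem_of_tendsto hsum
      (Eventually.of_forall fun N => sum_mem fun n _ => hmem n)
  · intro η
    have h := ((ContinuousLinearMap.apply ℂ H η).continuous.tendsto _).comp hsum
    refine h.congr fun N => ?_
    simp [hiter]
  · intro η
    have hTn1 : ∀ n, (T' ^ n) 1 = 1 := fun n => by
      induction n with
      | zero => simp
      | succ n ih => rw [pow_succ', Module.End.mul_apply, ih]; exact hT.unital
    have h := ((ContinuousLinearMap.apply ℂ H η).continuous.tendsto _).comp
      hsummable.tendsto_atTop_zero
    have h2 := h.const_sub η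
    simp only [map_zero, sub_zero] at h2
    refine h2.congr fun n => ?_
    have e : r = 1 - p := by rw [hpdef, sub_sub_cancel]
    rw [hiter, e, map_sub, hTn1]
    simp
end
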